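/- For every n ≥ 1, if (ℤ/2ℤ)^{*n} denotes the free product of n copies of ℤ/2ℤ, each marked by its nonidentity element, then the graph G((ℤ/2ℤ)^{*n}, ℕ) is an n-regular acyclic Borel graph with Borel chromatic number χ_B(G((ℤ/2ℤ)^{*n}, ℕ)) = n + 1. -/

import Mathlib

/-- The left shift action of a group `G` on the product space `G → X`:
`(γ • y) β = y (γ⁻¹ * β)`. -/
def shift {G : Type*} [Group G] {X : Type*} (γ : G) (y : G → X) : G → X :=
  fun β => y (γ⁻¹ * β)

/-- The free part `Free(X^G)` of the left shift action of `G` on `G → X`. -/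
def freePart (G : Type*) [Group G] (X : Type*) : Set (G → X) :=
  {y | ∀ γ : G, γ ≠ 1 → shift γ y ≠ y}

/-- The Borel chromatic number of a (graph given by a) relation `G` on a measurable
space `X`: the least cardinality of a standard Borel space `Y` admitting a Borel
(measurable) coloring `c : X → Y` with `c x ≠ c y` whenever `G x y`. -/
noncomputable def borelChromaticNumber {X : Type} [mX : MeasurableSpace X]
    (G : X → X → Prop) : Cardinal :=
  sInf {κ : Cardinal | ∃ (Y : Type) (mY : MeasurableSpace Y),
    @StandardBorelSpace Y mY ∧ Cardinal.mk Y = κ ∧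
    ∃ c : X → Y, @Measurable X Y mX mY c ∧ ∀ x y, G x y → c x ≠ c y}

/-- The adjacency relation of the graph `G(Γ, X)` on the free part `Free(X^Γ)` determined
by a set `S` of generators of `Γ`: `x` and `y` are adjacent iff some `γ ∈ S` shifts `x`
to `y` or `y` to `x`. -/
def cayleyAdj {Γ : Type} [Group Γ] (S : Set Γ) (X : Type) :
    ↥(freePart Γ X) → ↥(freePart Γ X) → Prop :=
  fun x y => ∃ γ ∈ S,
    shift γ (x : Γ → X) = (y : Γ → X) ∨ shift γ (y : Γ → X) = (x : Γ → X)

/-- The free product `(ℤ/2ℤ)^{*n}` of `n` copies of `ℤ/2ℤ`. -/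
abbrev Z2StarN (n : ℕ) : Type := Monoid.CoprodI fun _ : Fin n => Multiplicative (ZMod 2)

/-- The marked generator of the `i`th copy of `ℤ/2ℤ` in `(ℤ/2ℤ)^{*n}`:
the (image of the) unique nonidentity element. -/
def z2gen (n : ℕ) (i : Fin n) : Z2StarN n :=
  Monoid.CoprodI.of (i := i) (Multiplicative.ofAdd (1 : ZMod 2))

/-- A pruned forest of positions, graded by length. Plays are its infinite branches. -/
structure GameTree where
  P : Type
  len : P → ℕ
  par : P → P
  len_par : ∀ p, len (par p) = len p - 1
  par_zero : ∀ p, len p = 0 → par p = p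
  ext : ∀ p, ∃ q, par q = p ∧ len q = len p + 1

namespace GameTree

variable {G : GameTree}

/-- The initial segment of length `m` of a position. -/
def tr (G : GameTree) (m : ℕ) (p : G.P) : G.P := G.par^[G.len p - m] p

lemma len_iter (j : ℕ) (p : G.P) : G.len (G.par^[j] p) = G.len p - j := by
  induction j with
  | zero => rfl
  | succ j ih => rw [Function.iterate_succ_apply', G.len_par, ih]; omega

lemma len_tr {m : ℕ} {p : G.P} (h : m ≤ G.len p) : G.len (G.tr m p) = m := by
  rw [tr, len_iter]; omega

lemma tr_of_le {m : ℕ} {p : G.P} (h : G.len p ≤ m) : G.tr m p = p := by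
  rw [tr, Nat.sub_eq_zero_of_le h]; rfl

lemma tr_par {m : ℕ} {p : G.P} (h : m < G.len p) : G.tr m (G.par p) = G.tr m p := by
  rw [tr, tr, G.len_par, ← Function.iterate_succ_apply]
  congr 2; omega

lemma tr_tr {m m' : ℕ} (h : m ≤ m') (p : G.P) : G.tr m (G.tr m' p) = G.tr m p := by
  rcases le_total (G.len p) m' with h' | h'
  · rw [tr_of_le h']
  · rw [tr, len_tr h', tr, tr, ← Function.iterate_add_apply]
    congr 2; omega

lemma par_eq_tr (p : G.P) : G.par p = G.tr (G.len p - 1) p := by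
  rcases Nat.eq_zero_or_pos (G.len p) with h | h
  · rw [tr_of_le (by omega), G.par_zero _ h]
  · rw [tr, show G.len p - (G.len p - 1) = 1 by omega]; rfl

/-- `q` is an immediate successor of `p`. -/
def Child (G : GameTree) (q p : G.P) : Prop := G.par q = p ∧ G.len q = G.len p + 1

lemma Child.tr_eq {q p : G.P} (h : G.Child q p) {m : ℕ} (hm : m ≤ G.len p) :
    G.tr m q = G.tr m p := by
  rw [← h.1, tr_par]; have := h.2; omega

/-- A strategy chooses a successor of every position. -/
def Strat (G : GameTree) : Type := {f : G.P → G.P // ∀ p, G.Child (f p) p}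

instance : CoeFun G.Strat fun _ => G.P → G.P := ⟨Subtype.val⟩

/-- Some strategy. -/
noncomputable def someStrat (G : GameTree) : G.Strat :=
  ⟨fun p => (G.ext p).choose, fun p => (G.ext p).choose_spec⟩

lemma Strat.child (σ : G.Strat) (p : G.P) : G.Child (σ p) p := σ.2 p

lemma Strat.len (σ : G.Strat) (p : G.P) : G.len (σ p) = G.len p + 1 := (σ.2 p).2

lemma Strat.par (σ : G.Strat) (p : G.P) : G.par (σ p) = p := (σ.2 p).1

/-- An infinite branch, presented by its sequence of initial segments. -/
def IsPlay (G : GameTree) (x : ℕ → G.P) : Prop := ∀ n, G.len (x n) = n ∧ G.par (x (n + 1)) = x n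

lemma IsPlay.len {x : ℕ → G.P} (h : G.IsPlay x) (n : ℕ) : G.len (x n) = n := (h n).1

lemma IsPlay.child {x : ℕ → G.P} (h : G.IsPlay x) (n : ℕ) : G.Child (x (n + 1)) (x n) :=
  ⟨(h n).2, by rw [h.len, h.len]⟩

lemma IsPlay.tr {x : ℕ → G.P} (h : G.IsPlay x) {m n : ℕ} (hmn : m ≤ n) : G.tr m (x n) = x m := by
  induction n, hmn using Nat.le_induction with
  | base => exact tr_of_le (h.len m).le
  | succ n hn ih => rw [(h.child n).tr_eq (by rw [h.len]; exact hn), ih]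

/-- The play `x` follows `σ` at the levels belonging to the player of parity `b`. -/
def Cons (b : ℕ) (f : G.P → G.P) (x : ℕ → G.P) : Prop :=
  ∀ n, (n + b) % 2 = 0 → x (n + 1) = f (x n)

/-- The player of parity `b` can force the play to meet `U` from `p` on. -/
def ForcedBy (b : ℕ) (U : Set G.P) (p : G.P) (ρ : G.Strat) : Prop :=
  ∀ x, G.IsPlay x → x (G.len p) = p →
    (∀ m, G.len p ≤ m → (m + b) % 2 = 0 → x (m + 1) = ρ (x m)) → ∃ m, G.len p ≤ m ∧ x m ∈ U

/-- The player of parity `b` has a strategy to meet `U` from `p` on. -/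
def Force (b : ℕ) (U : Set G.P) (p : G.P) : Prop := ∃ ρ : G.Strat, ForcedBy b U p ρ

lemma force_of_mem {b : ℕ} {U : Set G.P} {p : G.P} (h : p ∈ U) : Force b U p :=
  ⟨G.someStrat, fun x _ hp _ => ⟨_, le_rfl, by rwa [hp]⟩⟩

open Classical in
lemma force_of_child {b : ℕ} {U : Set G.P} {p q : G.P} (hb : (G.len p + b) % 2 = 0)
    (hq : G.Child q p) (h : Force b U q) : Force b U p := by
  obtain ⟨ρ, hρ⟩ := h
  refine ⟨⟨fun z => if z = p then q else ρ z, fun z => ?_⟩, fun x hx hp hc => ?_⟩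
  · dsimp only
    split_ifs with h
    · exact h ▸ hq
    · exact ρ.child z
  · have hlq := hq.2
    have h1 : x (G.len q) = q := by
      rw [hlq, hc _ le_rfl hb, hp]; simp
    obtain ⟨m, hm, hU⟩ := hρ x hx h1 (fun m hm hmb => by
      rw [hc m (by omega) hmb]
      have : x m ≠ p := fun h => by have := hx.len m; rw [h] at this; omega
      simp [this])
    exact ⟨m, by omega, hU⟩

open Classical in
lemma force_of_forall_child {b : ℕ} {U : Set G.P} {p : G.P}
    (h : ∀ q, G.Child q p → Force b U q) : Force b U p := by
  have : Nonempty G.Strat := ⟨G.someStrat⟩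
  choose! ρ hρ using h
  refine ⟨⟨fun z => ρ (G.tr (G.len p + 1) z) z, fun z => (ρ _).child z⟩, fun x hx hp hc => ?_⟩
  have hch : G.Child (x (G.len p + 1)) p := by
    have := hx.child (G.len p); rwa [hp] at this
  obtain ⟨m, hm, hU⟩ := hρ _ hch x hx (by rw [hx.len]) (fun m hm hmb => by
    rw [hx.len] at hm
    rw [hc m (by omega) hmb]
    simp only [hx.tr hm])
  exact ⟨m, by rw [hx.len] at hm; omega, hU⟩

lemma exists_child_not_force {b : ℕ} {U : Set G.P} {p : G.P}
    (h : ¬ Force b U p) : ∃ q, G.Child q p ∧ ¬ Force b U q := by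
  by_contra! hc
  exact h (force_of_forall_child hc)

open Classical in
/-- The strategy that, from the first initial segment of length at least `l` that forces `U`,
follows a strategy witnessing this. -/
noncomputable def attract (b : ℕ) (U : Set G.P) (l : ℕ) : G.Strat :=
  ⟨fun z => if h : ∃ m, l ≤ m ∧ Force b U (G.tr m z) then
      (Nat.find_spec h).2.choose z else G.someStrat z, fun z => by
    dsimp only; split_ifs
    · exact Strat.child _ z
    · exact Strat.child _ z⟩

open Classical in
lemma attract_meets {b : ℕ} {U : Set G.P} {l : ℕ} {x : ℕ → G.P} (hx : G.IsPlay x)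
    (hf : ∃ m, l ≤ m ∧ Force b U (x m))
    (hc : ∀ n, (n + b) % 2 = 0 → (∃ m, l ≤ m ∧ m ≤ n ∧ Force b U (x m)) →
      x (n + 1) = attract b U l (x n)) : ∃ m, l ≤ m ∧ x m ∈ U := by
  obtain ⟨hl, hF⟩ := Nat.find_spec hf
  set m₀ := Nat.find hf with hm₀
  obtain ⟨m, hm, hU⟩ := hF.choose_spec x hx (by rw [hx.len]) (fun n hn hnb => by
    rw [hx.len] at hn
    rw [hc n hnb ⟨m₀, hl, hn, hF⟩]
    have h : ∃ m, l ≤ m ∧ Force b U (G.tr m (x n)) := ⟨m₀, hl, by rwa [hx.tr hn]⟩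
    have key : ∀ m (hm : Force b U (G.tr m (x n))), m = m₀ →
        hm.choose (x n) = hF.choose (x n) := by
      rintro m hm rfl
      have : G.tr m₀ (x n) = x m₀ := hx.tr hn
      simp [this]
    have hfind : Nat.find h = m₀ := by
      rw [Nat.find_eq_iff]
      refine ⟨⟨hl, by rwa [hx.tr hn]⟩, fun j hj hj' => Nat.find_min hf hj ?_⟩
      rwa [hx.tr (by omega)] at hj'
    simp only [attract, dif_pos h]
    exact key _ _ hfind)
  exact ⟨m, by rw [hx.len] at hm; omega, hU⟩

/-- A length-preserving map of game trees. -/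
structure Hom (G H : GameTree) where
  toFun : G.P → H.P
  len_eq : ∀ p, H.len (toFun p) = G.len p
  par_eq : ∀ p, H.par (toFun p) = toFun (G.par p)

instance {G H : GameTree} : CoeFun (Hom G H) fun _ => G.P → H.P := ⟨Hom.toFun⟩

/-- The identity map. -/
def Hom.id (G : GameTree) : Hom G G := ⟨fun p => p, fun _ => rfl, fun _ => rfl⟩

/-- Composition of maps of game trees. -/
def Hom.comp {G H K : GameTree} (f : Hom H K) (g : Hom G H) : Hom G K :=
  ⟨fun p => f (g p), fun p => by rw [f.len_eq, g.len_eq], fun p => by rw [f.par_eq, g.par_eq]⟩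

lemma Hom.child {G H : GameTree} (f : Hom G H) {q p : G.P} (h : G.Child q p) :
    H.Child (f q) (f p) :=
  ⟨by rw [f.par_eq, h.1], by rw [f.len_eq, f.len_eq, h.2]⟩

lemma Hom.isPlay {G H : GameTree} (f : Hom G H) {x : ℕ → G.P} (h : G.IsPlay x) :
    H.IsPlay fun n => f (x n) :=
  fun n => ⟨by rw [f.len_eq, h.len], by rw [f.par_eq, (h n).2]⟩

/-- A covering of game trees in the sense of Martin, which is trivial on positions of length
at most `k`. -/
structure Cover (k : ℕ) (G' G : GameTree) extends Hom G' G where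
  φ : ℕ → G'.Strat → G.Strat
  loc : ∀ b σ σ' n, (∀ p, G'.len p ≤ n → (G'.len p + b) % 2 = 0 → σ p = σ' p) →
    ∀ p, G.len p ≤ n → (G.len p + b) % 2 = 0 → φ b σ p = φ b σ' p
  lift : ∀ b (σ : G'.Strat) x, G.IsPlay x → Cons b (φ b σ) x →
    ∃ x', G'.IsPlay x' ∧ Cons b σ x' ∧ ∀ n, toFun (x' n) = x n
  inj : ∀ p q, G'.len p ≤ k → toFun p = toFun q → p = q
  surj : ∀ p, G.len p ≤ k → ∃ p', toFun p' = p
  fix : ∀ b (σ : G'.Strat) p, G'.len p < k → (G'.len p + b) % 2 = 0 →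
    φ b σ (toFun p) = toFun (σ p)

instance {k : ℕ} {G H : GameTree} : CoeFun (Cover k G H) fun _ => G.P → H.P :=
  ⟨fun C => C.toHom.toFun⟩

/-- Weakening of the level of triviality. -/
def Cover.mono {k l : ℕ} (h : k ≤ l) {G' G : GameTree} (C : Cover l G' G) : Cover k G' G :=
  { C with
    inj := fun p q hp => C.inj p q (hp.trans h)
    surj := fun p hp => C.surj p (hp.trans h)
    fix := fun b σ p hp => C.fix b σ p (hp.trans_le h) }

/-- The identity covering. -/
def Cover.id (k : ℕ) (G : GameTree) : Cover k G G :=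
  { Hom.id G with
    φ := fun _ σ => σ
    loc := fun _ _ _ _ h => h
    lift := fun _ _ x hx hc => ⟨x, hx, hc, fun _ => rfl⟩
    inj := fun _ _ _ h => h
    surj := fun p _ => ⟨p, rfl⟩
    fix := fun _ _ _ _ _ => rfl }

/-- Composition of coverings. -/
def Cover.comp {k : ℕ} {G H K : GameTree} (C : Cover k H K) (D : Cover k G H) : Cover k G K :=
  { C.toHom.comp D.toHom with
    φ := fun b σ => C.φ b (D.φ b σ)
    loc := fun b σ σ' n h => C.loc b _ _ n (D.loc b σ σ' n h)
    lift := fun b σ x hx hc => by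
      obtain ⟨y, hy, hyc, hyx⟩ := C.lift b _ x hx hc
      obtain ⟨z, hz, hzc, hzy⟩ := D.lift b _ y hy hyc
      exact ⟨z, hz, hzc, fun n => by simp only [Hom.comp]; rw [hzy, hyx]⟩
    inj := fun p q hp h => D.inj p q hp (C.inj _ _ (by rwa [D.len_eq]) h)
    surj := fun p hp => by
      obtain ⟨q, rfl⟩ := C.surj p hp
      obtain ⟨r, rfl⟩ := D.surj q (by rwa [C.len_eq] at hp)
      exact ⟨r, rfl⟩
    fix := fun b σ p hp hb => by
      simp only [Hom.comp]
      rw [C.fix b _ _ (by rwa [D.len_eq]) (by rwa [D.len_eq]), D.fix b _ _ hp hb] }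

/-- A set of plays whose membership is decided at some fixed finite level. -/
def LevelDet (G : GameTree) (X : Set (ℕ → G.P)) : Prop :=
  ∃ (m : ℕ) (E : Set G.P), ∀ x, G.IsPlay x → (x ∈ X ↔ x m ∈ E)

end GameTree

namespace GameTree

section InverseLimit

variable {G : ℕ → GameTree}

/-- The inverse limit of a sequence of game trees that stabilises on initial levels. -/
structure Tower (G : ℕ → GameTree) (k : ℕ) where
  K : ℕ → ℕ
  le : ∀ m, k + m ≤ K m
  C : ∀ m, Cover (K m) (G (m + 1)) (G m)

namespace Tower

variable {k : ℕ} (T : Tower G k)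

/-- Coherent sequences of positions. -/
def Pos : Type := {p : ∀ m, (G m).P // ∀ m, T.C m (p (m + 1)) = p m}

variable {T}

lemma Pos.len_eq (p : T.Pos) (m : ℕ) : (G m).len (p.1 m) = (G 0).len (p.1 0) := by
  induction m with
  | zero => rfl
  | succ m ih => rw [← ih, ← p.2 m, (T.C m).len_eq]

lemma Pos.exists_zero {q : (G 0).P} (hq : (G 0).len q ≤ k) : ∃ e : T.Pos, e.1 0 = q := by
  have step : ∀ m (q : {q : (G m).P // (G m).len q ≤ k}),
      ∃ q' : {q : (G (m + 1)).P // (G (m + 1)).len q ≤ k}, T.C m q'.1 = q.1 := fun m q => by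
    obtain ⟨q', h⟩ := (T.C m).surj q.1 (by have := T.le m; have := q.2; omega)
    exact ⟨⟨q', by rw [← (T.C m).len_eq, h]; exact q.2⟩, h⟩
  choose f hf using step
  let s : ∀ m, {q : (G m).P // (G m).len q ≤ k} := fun m => Nat.rec ⟨q, hq⟩ (fun m q => f m q) m
  exact ⟨⟨fun m => (s m).1, fun m => hf m (s m)⟩, rfl⟩

/-- The tower with its bottom removed. -/
def shift (T : Tower G k) : Tower (fun m => G (m + 1)) (k + 1) :=
  ⟨fun m => T.K (m + 1), fun m => by have := T.le (m + 1); omega, fun m => T.C (m + 1)⟩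

end Tower

lemma Tower.Pos.exists_eq (m : ℕ) : ∀ {G : ℕ → GameTree} {k : ℕ} (T : Tower G k) (q : (G m).P),
    (G m).len q ≤ k + m → ∃ e : T.Pos, e.1 m = q := by
  induction m with
  | zero => exact fun T q hq => Pos.exists_zero hq
  | succ m ih =>
    intro G k T q hq
    obtain ⟨e, he⟩ := ih T.shift q (by omega)
    exact ⟨⟨fun j => Nat.casesOn j (T.C 0 (e.1 0)) (fun j => e.1 j), fun j => by
      cases j with
      | zero => rfl
      | succ j => exact e.2 j⟩, he⟩

namespace Tower

variable {k : ℕ} {T : Tower G k}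

lemma Pos.ext_at {e e' : T.Pos} {m : ℕ} (hm : (G m).len (e.1 m) ≤ k + m)
    (h : e.1 m = e'.1 m) : e = e' := by
  refine Subtype.ext (funext fun j => ?_)
  rcases le_total m j with hj | hj
  · induction j, hj using Nat.le_induction with
    | base => exact h
    | succ j hj ih =>
      refine (T.C j).inj _ _ ?_ (by rw [e.2, e'.2, ih])
      have := T.le j
      rw [e.len_eq] at *; omega
  · induction hj using Nat.decreasingInduction with
    | self => exact h
    | of_succ j hj ih => rw [← e.2, ← e'.2, ih]

/-- The limit of a tower. -/
def lim (T : Tower G k) : GameTree where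
  P := T.Pos
  len p := (G 0).len (p.1 0)
  par p := ⟨fun m => (G m).par (p.1 m), fun m => by rw [← (T.C m).par_eq, p.2]⟩
  len_par p := (G 0).len_par _
  par_zero p h := Subtype.ext (funext fun m => (G m).par_zero _ (by rw [p.len_eq, h]))
  ext p := by
    let m := (G 0).len (p.1 0) + 1
    obtain ⟨q, hq, hl⟩ := (G m).ext (p.1 m)
    rw [p.len_eq] at hl
    obtain ⟨e, he⟩ := Pos.exists_eq m T q (by omega)
    refine ⟨e, Pos.ext_at (m := m) ?_ (by simp only [he, hq]), ?_⟩
    · rw [(G m).len_par, he, hl]; omega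
    · rw [← e.len_eq m, he, hl]

lemma len_apply (e : T.lim.P) (m : ℕ) : (G m).len (e.1 m) = T.lim.len e := e.len_eq m

/-- The projection of the limit of a tower. -/
def proj (T : Tower G k) (m : ℕ) : Hom T.lim (G m) :=
  ⟨fun e => e.1 m, fun e => e.len_eq m, fun _ => rfl⟩

open Classical in
/-- The strategy in the `m`th stage that agrees with a strategy in the limit up to level
`k + m`. -/
noncomputable def restr (σ : T.lim.Strat) (m : ℕ) : (G m).Strat :=
  ⟨fun q => if h : (G m).len q ≤ k + m then (σ (Pos.exists_eq m T q h).choose).1 m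
    else (G m).someStrat q, fun q => by
    dsimp only
    split_ifs with h
    · have := (T.proj m).child (σ.child (Pos.exists_eq m T q h).choose)
      rwa [show T.proj m (Pos.exists_eq m T q h).choose = q from
        (Pos.exists_eq m T q h).choose_spec] at this
    · exact Strat.child _ _⟩

lemma restr_apply (σ : T.lim.Strat) {m : ℕ} (e : T.lim.P) (h : T.lim.len e ≤ k + m) :
    restr σ m (e.1 m) = (σ e).1 m := by
  have h' : (G m).len (e.1 m) ≤ k + m := by rwa [len_apply]
  have : (Pos.exists_eq m T _ h').choose = e :=
    Pos.ext_at (m := m) (by rw [(Pos.exists_eq m T _ h').choose_spec]; exact h')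
      (Pos.exists_eq m T _ h').choose_spec
  simp only [restr, dif_pos h', this]

lemma restr_congr {b n : ℕ} {σ σ' : T.lim.Strat}
    (h : ∀ p, T.lim.len p ≤ n → (T.lim.len p + b) % 2 = 0 → σ p = σ' p) (m : ℕ) (q : (G m).P)
    (hq : (G m).len q ≤ n) (hb : ((G m).len q + b) % 2 = 0) : restr σ m q = restr σ' m q := by
  by_cases h' : (G m).len q ≤ k + m
  · obtain ⟨e, rfl⟩ := Pos.exists_eq m T q h'
    have hl := len_apply e m
    rw [restr_apply σ e (by omega), restr_apply σ' e (by omega), h e (by omega) (by omega)]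
  · simp only [restr, dif_neg h']

/-- The iterated pushforward to stage `m` of the restriction to stage `m + i`. -/
noncomputable def push (b : ℕ) (σ : T.lim.Strat) : ℕ → ∀ m, (G m).Strat
  | 0, m => restr σ m
  | i + 1, m => (T.C m).φ b (push b σ i (m + 1))

lemma push_congr {b n : ℕ} {σ σ' : T.lim.Strat}
    (h : ∀ p, T.lim.len p ≤ n → (T.lim.len p + b) % 2 = 0 → σ p = σ' p) (i : ℕ) :
    ∀ m (q : (G m).P), (G m).len q ≤ n → ((G m).len q + b) % 2 = 0 →
      push b σ i m q = push b σ' i m q := by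
  induction i with
  | zero => exact restr_congr h
  | succ i ih => exact fun m q hq hb => (T.C m).loc b _ _ n (ih (m + 1)) q hq hb

lemma push_succ (b : ℕ) (σ : T.lim.Strat) (i : ℕ) : ∀ m (q : (G m).P),
    (G m).len q < k + m + i → ((G m).len q + b) % 2 = 0 →
      push b σ i m q = push b σ (i + 1) m q := by
  induction i with
  | zero =>
    intro m q hq hb
    obtain ⟨e, rfl⟩ := Pos.exists_eq m T q (by omega)
    have hl := len_apply e m
    have hl' := len_apply e (m + 1)
    have := T.le m
    have h1 := (T.C m).fix b (restr σ (m + 1)) (e.1 (m + 1)) (by omega) (by omega)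
    rw [e.2, restr_apply σ e (by omega), (σ e).2] at h1
    exact (restr_apply σ e (by omega)).trans h1.symm
  | succ i ih =>
    intro m q hq hb
    exact (T.C m).loc b _ _ (k + m + i) (fun p hp => ih (m + 1) p (by omega)) q (by omega) hb

lemma push_eq (b : ℕ) (σ : T.lim.Strat) {i j m : ℕ} (hij : i ≤ j) (q : (G m).P)
    (hq : (G m).len q < k + m + i) (hb : ((G m).len q + b) % 2 = 0) :
    push b σ i m q = push b σ j m q := by
  induction j, hij using Nat.le_induction with
  | base => rfl
  | succ j hj ih => rw [ih, push_succ b σ j m q (by omega) hb]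

/-- The strategy at stage `m` induced by a strategy in the limit. -/
noncomputable def limStrat (b : ℕ) (σ : T.lim.Strat) (m : ℕ) : (G m).Strat :=
  ⟨fun q => push b σ ((G m).len q + 1) m q, fun _ => Strat.child _ _⟩

lemma limStrat_eq (b : ℕ) (σ : T.lim.Strat) {m : ℕ} (q : (G m).P)
    (hb : ((G m).len q + b) % 2 = 0) :
    limStrat b σ m q = (T.C m).φ b (limStrat b σ (m + 1)) q := by
  change push b σ ((G m).len q + 1) m q = _
  rw [push_eq b σ (Nat.le_succ _) q (by omega) hb]
  refine (T.C m).loc b _ _ ((G m).len q) (fun p hp hpb => ?_) q le_rfl hb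
  exact (push_eq b σ (by omega) p (by omega) hpb).symm

lemma limStrat_apply (b : ℕ) (σ : T.lim.Strat) {m : ℕ} (e : T.lim.P)
    (h : T.lim.len e < k + m) (hb : (T.lim.len e + b) % 2 = 0) :
    limStrat b σ m (e.1 m) = (σ e).1 m := by
  have hl := len_apply e m
  rw [← restr_apply σ e h.le]
  exact (push_eq b σ (Nat.zero_le _) (e.1 m) (by omega) (by omega)).symm

lemma limStrat_lift (b : ℕ) (σ : T.lim.Strat) (x : ℕ → (G 0).P) (hx : (G 0).IsPlay x)
    (hc : Cons b (limStrat b σ 0) x) :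
    ∃ x' : ℕ → T.lim.P, T.lim.IsPlay x' ∧ Cons b σ x' ∧ ∀ n, (x' n).1 0 = x n := by
  have step : ∀ m (y : {y : ℕ → (G m).P // (G m).IsPlay y ∧ Cons b (limStrat b σ m) y}),
      ∃ z : {z : ℕ → (G (m + 1)).P // (G (m + 1)).IsPlay z ∧ Cons b (limStrat b σ (m + 1)) z},
        ∀ n, T.C m (z.1 n) = y.1 n := by
    rintro m ⟨y, hy, hyc⟩
    obtain ⟨z, hz, hzc, hzy⟩ := (T.C m).lift b (limStrat b σ (m + 1)) y hy (fun n hn => by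
      rw [hyc n hn, limStrat_eq b σ _ (by rwa [hy.len])])
    exact ⟨⟨z, hz, hzc⟩, hzy⟩
  choose f hf using step
  let s : ∀ m, {y : ℕ → (G m).P // (G m).IsPlay y ∧ Cons b (limStrat b σ m) y} :=
    fun m => Nat.rec ⟨x, hx, hc⟩ (fun m y => f m y) m
  let x' : ℕ → T.lim.P := fun n => ⟨fun m => (s m).1 n, fun m => hf m (s m) n⟩
  have hp : T.lim.IsPlay x' := fun n => ⟨hx.len n, Subtype.ext (funext fun m =>
    ((s m).2.1 n).2)⟩
  refine ⟨x', hp, fun n hn => ?_, fun n => rfl⟩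
  refine Pos.ext_at (m := n + 1) ?_ ?_
  · have := len_apply (x' (n + 1)) (n + 1)
    rw [hp.len] at this; omega
  · rw [← limStrat_apply b σ (x' n) (by rw [hp.len]; omega) (by rwa [hp.len])]
    exact (s (n + 1)).2.2 n hn

/-- The limit of a tower covers its bottom. -/
noncomputable def cover (T : Tower G k) : Cover k T.lim (G 0) :=
  { T.proj 0 with
    φ := fun b σ => limStrat b σ 0
    loc := fun _ _ _ _ h p hp hb => push_congr h _ 0 p hp hb
    lift := limStrat_lift
    inj := fun _ _ hp h => Pos.ext_at (m := 0) hp h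
    surj := fun p hp => Pos.exists_eq 0 T p hp
    fix := fun b σ p hp hb => limStrat_apply b σ p hp hb }

end Tower

end InverseLimit

end GameTree

namespace GameTree

section Closed

variable {G : GameTree}

/-- The positions comparable with `u`. -/
def comparable (u : G.P) : Set G.P := {z | G.tr (G.len z) u = z ∨ G.tr (G.len u) z = u}

lemma par_mem_comparable {u z : G.P} (h : z ∈ comparable u) : G.par z ∈ comparable u := by
  rcases Nat.eq_zero_or_pos (G.len z) with h0 | h0
  · rwa [G.par_zero z h0]
  have hl := G.len_par z
  rcases le_or_gt (G.len z) (G.len u) with hz | hz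
  · left
    have h' : G.tr (G.len z) u = z := by
      rcases h with h | h
      · exact h
      · rw [tr_of_le hz] at h; rw [h, tr_of_le le_rfl]
    rw [hl]
    conv_rhs => rw [par_eq_tr, ← h', tr_tr (by rw [len_tr hz]; omega), len_tr hz]
  · right
    rw [tr_par hz]
    rcases h with h | h
    · rw [tr_of_le hz.le] at h; rw [← h, tr_of_le le_rfl]
    · exact h

lemma exists_child_mem_comparable {u z : G.P} (h : z ∈ comparable u) :
    ∃ z', G.Child z' z ∧ z' ∈ comparable u := by
  rcases lt_or_ge (G.len z) (G.len u) with hz | hz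
  · have h' : G.tr (G.len z) u = z := by
      rcases h with h | h
      · exact h
      · rw [tr_of_le hz.le] at h; rw [h, tr_of_le le_rfl]
    refine ⟨G.tr (G.len z + 1) u, ⟨?_, len_tr hz⟩, Or.inl (by rw [len_tr hz])⟩
    conv_rhs => rw [← h']
    rw [par_eq_tr, len_tr hz, tr_tr (by omega)]; rfl
  · obtain ⟨z', hz'⟩ := G.ext z
    refine ⟨z', hz', Or.inr ?_⟩
    rw [Child.tr_eq hz' hz]
    rcases h with h | h
    · rw [tr_of_le hz] at h; rw [← h, tr_of_le le_rfl]
    · exact h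

lemma tr_of_mem_comparable {u z : G.P} (h : z ∈ comparable u) (hz : G.len z ≤ G.len u) :
    G.tr (G.len z) u = z := by
  rcases h with h | h
  · exact h
  · rw [tr_of_le hz] at h; rw [h, tr_of_le le_rfl]

lemma eq_of_mem_comparable {u z : G.P} (h : z ∈ comparable u) (hz : G.len z = G.len u) :
    z = u := by
  have := tr_of_mem_comparable h hz.le
  rwa [tr_of_le hz.ge, eq_comm] at this

lemma IsPlay.mem_comparable {x : ℕ → G.P} (hx : G.IsPlay x) (m n : ℕ) :
    x n ∈ comparable (x m) := by
  rcases le_total n m with h | h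
  · left; rw [hx.len, hx.tr h]
  · right; rw [hx.len, hx.tr h]

/-- A pruned subtree of the tree of extensions of the position `q` of length `l`. -/
structure IsSubtree (l : ℕ) (q : G.P) (S : Set G.P) : Prop where
  root : ∀ z ∈ S, l ≤ G.len z ∧ G.tr l z = q
  mem : q ∈ S
  par : ∀ z ∈ S, l < G.len z → G.par z ∈ S
  ext : ∀ z ∈ S, ∃ z' ∈ S, G.Child z' z

/-- A quasi-strategy of the first player after the position `q` of length `k + 1`. -/
structure IsOffer (k : ℕ) (q : G.P) (S : Set G.P) : Prop extends IsSubtree (k + 1) q S where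
  opp : ∀ z ∈ S, G.len z % 2 = 1 → ∀ z', G.Child z' z → z' ∈ S

/-- A quasi-strategy of the second player inside `S`, avoiding `D`. -/
structure IsReply (k : ℕ) (D S : Set G.P) (q : G.P) (c : Set G.P) : Prop
    extends IsSubtree (k + 2) q c where
  sub : ∀ z ∈ c, z ∈ S
  avoid : ∀ z ∈ c, z ∉ D
  opp : ∀ z ∈ c, G.len z % 2 = 0 → ∀ z' ∈ S, G.Child z' z → z' ∈ c

/-- The answer of the second player to an offer `S`: either accept, with a quasi-strategy
avoiding `D`, or reject, with a position of `S` that lies in `D`. -/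
def IsAnswer (k : ℕ) (D S : Set G.P) (q : G.P) (b : Bool) (c : Set G.P) : Prop :=
  (b = true ∧ IsReply k D S q c) ∨
    (b = false ∧ ∃ u ∈ S, u ∈ D ∧ k + 2 ≤ G.len u ∧ G.tr (k + 2) u = q ∧ c = comparable u)

/-- The positions of Martin's auxiliary game for the closed game of avoiding `D`. -/
@[ext]
structure UPos (G : GameTree) (k : ℕ) (D : Set G.P) where
  p : G.P
  S : Set G.P
  b : Bool
  c : Set G.P
  S_eq : G.len p ≤ k → S = ∅
  offer : k < G.len p → IsOffer k (G.tr (k + 1) p) S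
  bc_eq : G.len p ≤ k + 1 → b = false ∧ c = ∅
  answer : k + 1 < G.len p → IsAnswer k D S (G.tr (k + 2) p) b c
  mem : k + 1 < G.len p → p ∈ c

namespace UPos

variable {k : ℕ} {D : Set G.P}

/-- The parent in the auxiliary game. -/
def par (e : UPos G k D) : UPos G k D where
  p := G.par e.p
  S := if G.len e.p ≤ k + 1 then ∅ else e.S
  b := if G.len e.p ≤ k + 2 then false else e.b
  c := if G.len e.p ≤ k + 2 then ∅ else e.c
  S_eq h := by rw [G.len_par] at h; rw [if_pos (by omega)]
  offer h := by
    rw [G.len_par] at h; rw [if_neg (by omega), tr_par (by omega)]; exact e.offer (by omega)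
  bc_eq h := by
    rw [G.len_par] at h; rw [if_pos (by omega), if_pos (by omega)]; exact ⟨rfl, rfl⟩
  answer h := by
    rw [G.len_par] at h
    rw [if_neg (by omega), if_neg (by omega), if_neg (by omega), tr_par (by omega)]
    exact e.answer (by omega)
  mem h := by
    rw [G.len_par] at h
    rw [if_neg (by omega)]
    rcases e.answer (by omega) with ⟨-, hr⟩ | ⟨-, u, -, -, -, -, hc⟩
    · exact hr.par _ (e.mem (by omega)) (by omega)
    · have := e.mem (by omega)
      rw [hc] at this ⊢
      exact par_mem_comparable this

lemma ext_succ {e e' : UPos G k D} (hp : e.p = e'.p) (hS : k < G.len e.p → e.S = e'.S)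
    (hb : k + 1 < G.len e.p → e.b = e'.b ∧ e.c = e'.c) : e = e' := by
  refine UPos.ext hp ?_ ?_ ?_
  · by_cases h : k < G.len e.p
    · exact hS h
    · rw [e.S_eq (by omega), e'.S_eq (by rw [← hp]; omega)]
  · by_cases h : k + 1 < G.len e.p
    · exact (hb h).1
    · rw [(e.bc_eq (by omega)).1, (e'.bc_eq (by rw [← hp]; omega)).1]
  · by_cases h : k + 1 < G.len e.p
    · exact (hb h).2
    · rw [(e.bc_eq (by omega)).2, (e'.bc_eq (by rw [← hp]; omega)).2]

lemma exists_child (e : UPos G k D) :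
    ∃ e' : UPos G k D, e'.par = e ∧ G.len e'.p = G.len e.p + 1 := by
  have hpar : ∀ e' : UPos G k D, G.Child e'.p e.p → (k < G.len e.p → e'.S = e.S) →
      (k + 1 < G.len e.p → e'.b = e.b ∧ e'.c = e.c) →
      e'.par = e ∧ G.len e'.p = G.len e.p + 1 := by
    intro e' hc hS hb
    refine ⟨ext_succ hc.1 ?_ ?_, hc.2⟩
    · intro h
      simp only [par, hc.1, hc.2] at h ⊢
      rw [if_neg (by omega)]; exact hS h
    · intro h
      simp only [par, hc.1, hc.2] at h ⊢
      rw [if_neg (by omega), if_neg (by omega)]; exact hb h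
  rcases lt_trichotomy (G.len e.p) k with h | h | h
  · obtain ⟨q, hq⟩ := G.ext e.p
    have hl := hq.2
    exact ⟨⟨q, ∅, false, ∅, fun _ => rfl, fun _ => by omega, fun _ => ⟨rfl, rfl⟩,
      fun _ => by omega, fun _ => by omega⟩,
      hpar _ hq (fun _ => by omega) (fun _ => by omega)⟩
  · obtain ⟨q, hq⟩ := G.ext e.p
    have hl := hq.2
    refine ⟨⟨q, {z | k + 1 ≤ G.len z ∧ G.tr (k + 1) z = q}, false, ∅, fun _ => by omega,
      fun _ => ?_, fun _ => ⟨rfl, rfl⟩, fun _ => by omega, fun _ => by omega⟩,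
      hpar _ hq (fun _ => by omega) (fun _ => by omega)⟩
    have hqq : G.tr (k + 1) q = q := tr_of_le (by omega)
    rw [hqq]
    refine ⟨⟨fun z hz => hz, ⟨by omega, hqq⟩, fun z hz hl => ⟨?_, ?_⟩, fun z hz => ?_⟩,
      fun z hz _ z' hz' => ⟨?_, ?_⟩⟩
    · rw [G.len_par]; omega
    · rw [tr_par hl]; exact hz.2
    · obtain ⟨z', hz'⟩ := G.ext z
      exact ⟨z', ⟨by have := hz.1; omega, by rw [Child.tr_eq hz' hz.1]; exact hz.2⟩, hz'⟩
    · have := hz'.2; have := hz.1; omega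
    · rw [Child.tr_eq hz' hz.1]; exact hz.2
  rcases Nat.lt_or_ge (k + 1) (G.len e.p) with h1 | h1
  · have key : ∃ q, G.Child q e.p ∧ q ∈ e.c := by
      rcases e.answer h1 with ⟨-, hr⟩ | ⟨-, u, -, -, -, -, hc⟩
      · obtain ⟨q, hq, hq'⟩ := hr.ext _ (e.mem h1)
        exact ⟨q, hq', hq⟩
      · have := e.mem h1
        rw [hc] at this ⊢
        exact exists_child_mem_comparable this
    obtain ⟨q, hq, hqc⟩ := key
    have hl := hq.2
    refine ⟨⟨q, e.S, e.b, e.c, fun _ => by omega, fun _ => ?_, fun _ => by omega, fun _ => ?_,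
      fun _ => hqc⟩, hpar _ hq (fun _ => rfl) (fun _ => ⟨rfl, rfl⟩)⟩
    · rw [hq.tr_eq (by omega)]; exact e.offer h
    · rw [hq.tr_eq (by omega)]; exact e.answer h1
  · have ho := e.offer h
    have hl1 : G.len e.p = k + 1 := by omega
    rw [tr_of_le h1] at ho
    by_cases hu : ∃ u ∈ e.S, u ∈ D ∧ k + 2 ≤ G.len u
    · obtain ⟨u, huS, huD, hul⟩ := hu
      have hq : G.Child (G.tr (k + 2) u) e.p := by
        refine ⟨?_, by rw [len_tr hul]; omega⟩
        rw [par_eq_tr, len_tr hul, tr_tr (by omega)]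
        exact (ho.root u huS).2
      have hl := hq.2
      refine ⟨⟨G.tr (k + 2) u, e.S, false, comparable u, fun _ => by omega, fun _ => ?_,
        fun _ => by omega, fun _ => Or.inr ⟨rfl, u, huS, huD, hul, ?_, rfl⟩, fun _ => Or.inl ?_⟩,
        hpar _ hq (fun _ => rfl) (fun _ => by omega)⟩
      · rw [hq.tr_eq (by omega), tr_of_le h1]; exact ho
      · rw [tr_tr le_rfl]
      · rw [len_tr hul]
    · push Not at hu
      obtain ⟨q, hqS, hq⟩ := ho.ext _ ho.mem
      have hl := hq.2
      have hqq : G.tr (k + 2) q = q := tr_of_le (by omega)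
      refine ⟨⟨q, e.S, true, {z | z ∈ e.S ∧ k + 2 ≤ G.len z ∧ G.tr (k + 2) z = q},
        fun _ => by omega, fun _ => ?_, fun _ => by omega, fun _ => Or.inl ⟨rfl, ?_⟩,
        fun _ => ⟨hqS, by omega, hqq⟩⟩, hpar _ hq (fun _ => rfl) (fun _ => by omega)⟩
      · rw [hq.tr_eq (by omega), tr_of_le h1]; exact ho
      · rw [hqq]
        refine ⟨⟨fun z hz => hz.2, ⟨hqS, by omega, hqq⟩, fun z hz hl => ⟨?_, ?_, ?_⟩,
          fun z hz => ?_⟩,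
          fun z hz => hz.1, fun z hz hD => ?_, fun z hz _ z' hz' hcz => ⟨hz', ?_, ?_⟩⟩
        · exact ho.par z hz.1 (by omega)
        · rw [G.len_par]; omega
        · rw [tr_par hl]; exact hz.2.2
        · obtain ⟨z', hz', hcz⟩ := ho.ext z hz.1
          exact ⟨z', ⟨hz', by have := hcz.2; have := hz.2.1; omega,
            by rw [hcz.tr_eq hz.2.1]; exact hz.2.2⟩, hcz⟩
        · have := hu z hz.1 hD; have := hz.2.1; omega
        · have := hcz.2; have := hz.2.1; omega
        · rw [hcz.tr_eq hz.2.1]; exact hz.2.2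

end UPos

/-- Martin's auxiliary game. -/
def unravel (G : GameTree) (k : ℕ) (D : Set G.P) : GameTree where
  P := UPos G k D
  len e := G.len e.p
  par := UPos.par
  len_par e := G.len_par e.p
  par_zero e h := UPos.ext_succ (G.par_zero _ h)
    (fun h' => by simp only [UPos.par, G.par_zero _ h] at h'; omega)
    (fun h' => by simp only [UPos.par, G.par_zero _ h] at h'; omega)
  ext e := e.exists_child

variable {k : ℕ} {D : Set G.P}

/-- The projection of the auxiliary game to the original one. -/
def unravelHom (G : GameTree) (k : ℕ) (D : Set G.P) : Hom (unravel G k D) G :=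
  ⟨fun e => e.p, fun _ => rfl, fun _ => rfl⟩

lemma unravel_child {e e' : (unravel G k D).P} (h : (unravel G k D).Child e' e) :
    G.Child e'.p e.p ∧ (k < G.len e.p → e'.S = e.S) ∧
      (k + 1 < G.len e.p → e'.b = e.b ∧ e'.c = e.c) := by
  obtain ⟨h1, h2⟩ := h
  change UPos.par e' = e at h1
  change G.len e'.p = G.len e.p + 1 at h2
  subst h1
  refine ⟨⟨rfl, h2⟩, fun h => ?_, fun h => ?_⟩
  · simp only [UPos.par] at h h2 ⊢
    rw [if_neg (by omega)]
  · simp only [UPos.par] at h h2 ⊢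
    rw [if_neg (by omega), if_neg (by omega)]; exact ⟨rfl, rfl⟩

/-- The unique position of the auxiliary game above a short position. -/
def unravelShort (p : G.P) (h : G.len p ≤ k) : UPos G k D :=
  ⟨p, ∅, false, ∅, fun _ => rfl, fun _ => by omega, fun _ => ⟨rfl, rfl⟩, fun _ => by omega,
    fun _ => by omega⟩

/-- The play of the auxiliary game given by a play, an offer and an answer. -/
def unravelPlay {x : ℕ → G.P} (hx : G.IsPlay x) {S : Set G.P} {b : Bool} {c : Set G.P}
    (hS : IsOffer k (x (k + 1)) S) (hc : IsAnswer k D S (x (k + 2)) b c)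
    (hm : ∀ n, k + 1 < n → x n ∈ c) (n : ℕ) : (unravel G k D).P where
  p := x n
  S := if n ≤ k then ∅ else S
  b := if n ≤ k + 1 then false else b
  c := if n ≤ k + 1 then ∅ else c
  S_eq h := by rw [hx.len] at h; rw [if_pos h]
  offer h := by rw [hx.len] at h; rw [if_neg (by omega), hx.tr h]; exact hS
  bc_eq h := by rw [hx.len] at h; rw [if_pos h, if_pos h]; exact ⟨rfl, rfl⟩
  answer h := by
    rw [hx.len] at h
    rw [if_neg (by omega), if_neg (by omega), if_neg (by omega), hx.tr h]; exact hc
  mem h := by rw [hx.len] at h; rw [if_neg (by omega)]; exact hm n h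

section

variable {x : ℕ → G.P} (hx : G.IsPlay x) {S : Set G.P} {b : Bool} {c : Set G.P}
    (hS : IsOffer k (x (k + 1)) S) (hc : IsAnswer k D S (x (k + 2)) b c)
    (hm : ∀ n, k + 1 < n → x n ∈ c)

lemma unravelPlay_isPlay : (unravel G k D).IsPlay (unravelPlay hx hS hc hm) := by
  refine fun n => ⟨hx.len n, UPos.ext_succ (hx n).2 ?_ ?_⟩
  · intro h
    change k < G.len (G.par (x (n + 1))) at h
    rw [(hx n).2, hx.len] at h
    simp only [unravel, unravelPlay, UPos.par, hx.len]
    rw [if_neg (by omega), if_neg (by omega), if_neg (by omega)]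
  · intro h
    change k + 1 < G.len (G.par (x (n + 1))) at h
    rw [(hx n).2, hx.len] at h
    simp only [unravel, unravelPlay, UPos.par, hx.len]
    rw [if_neg (by omega), if_neg (by omega), if_neg (by omega), if_neg (by omega),
      if_neg (by omega), if_neg (by omega)]
    exact ⟨rfl, rfl⟩

lemma unravelPlay_cons {a : ℕ} {σ : (unravel G k D).Strat}
    (h : ∀ n, (n + a) % 2 = 0 → (σ (unravelPlay hx hS hc hm n)).p = x (n + 1))
    (hk : (k + a) % 2 = 0 → (σ (unravelPlay hx hS hc hm k)).S = S)
    (hk1 : (k + 1 + a) % 2 = 0 → (σ (unravelPlay hx hS hc hm (k + 1))).b = b ∧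
      (σ (unravelPlay hx hS hc hm (k + 1))).c = c) :
    Cons a σ (unravelPlay hx hS hc hm) := by
  intro n hn
  obtain ⟨-, h1, h2⟩ := unravel_child (σ.child (unravelPlay hx hS hc hm n))
  have hl : G.len (unravelPlay hx hS hc hm n).p = n := hx.len n
  rw [hl] at h1 h2
  refine UPos.ext_succ (h n hn).symm ?_ ?_
  · intro hkn
    change k < G.len (x (n + 1)) at hkn
    rw [hx.len] at hkn
    rcases Nat.lt_or_ge k n with h' | h'
    · rw [h1 h']; simp only [unravelPlay]; rw [if_neg (by omega), if_neg (by omega)]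
    · obtain rfl : n = k := by omega
      rw [hk hn]; simp only [unravelPlay]; rw [if_neg (by omega)]
  · intro hkn
    change k + 1 < G.len (x (n + 1)) at hkn
    rw [hx.len] at hkn
    rcases Nat.lt_or_ge (k + 1) n with h' | h'
    · rw [(h2 h').1, (h2 h').2]; simp only [unravelPlay]
      rw [if_neg (by omega), if_neg (by omega), if_neg (by omega), if_neg (by omega)]
      exact ⟨rfl, rfl⟩
    · obtain rfl : n = k + 1 := by omega
      rw [(hk1 hn).1, (hk1 hn).2]; simp only [unravelPlay]
      rw [if_neg (by omega), if_neg (by omega)]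
      exact ⟨rfl, rfl⟩

end

lemma unravelPlay_forced {x : ℕ → G.P} (hx : G.IsPlay x) {S : Set G.P} {m : ℕ}
    (hS : IsOffer k (x (k + 1)) S)
    (hc : IsAnswer k D S (x (k + 2)) false (comparable (x m)))
    (hm : ∀ n, k + 1 < n → x n ∈ comparable (x m)) (σ : (unravel G k D).Strat) {n : ℕ}
    (hn : k + 1 < n) (hnm : n < m) : (σ (unravelPlay hx hS hc hm n)).p = x (n + 1) := by
  obtain ⟨h0, -, h2⟩ := unravel_child (σ.child (unravelPlay hx hS hc hm n))
  have hl : G.len (unravelPlay hx hS hc hm n).p = n := hx.len n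
  rw [hl] at h2
  have hl' := h0.2
  rw [hl] at hl'
  have hmem := (σ (unravelPlay hx hS hc hm n)).mem (by omega)
  have hcc : (unravelPlay hx hS hc hm n).c = comparable (x m) := if_neg (by omega)
  rw [(h2 hn).2, hcc] at hmem
  have := tr_of_mem_comparable hmem (by rw [hx.len, hl']; omega)
  rw [hl', hx.tr (by omega)] at this
  exact this.symm

open Classical in
/-- The part of a strategy concerning the player of parity `b` and levels up to `n`. -/
noncomputable def trunc (b n : ℕ) (σ : G.Strat) (p : G.P) : G.P :=
  if G.len p ≤ n ∧ (G.len p + b) % 2 = 0 then σ p else p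

lemma trunc_apply {b n : ℕ} {σ : G.Strat} {p : G.P} (h : G.len p ≤ n)
    (hb : (G.len p + b) % 2 = 0) : trunc b n σ p = σ p := if_pos ⟨h, hb⟩

open Classical in
/-- Push a strategy of the auxiliary game forward: follow it at positions that can be lifted
according to the relation `L`, and follow `A` elsewhere. -/
noncomputable def pushforward (L : (UPos G k D → UPos G k D) → UPos G k D → Prop)
    (A : (UPos G k D → UPos G k D) → G.P → G.Strat) (b : ℕ) (σ : (unravel G k D).Strat) :
    G.Strat :=
  ⟨fun p => if h : ∃ e : UPos G k D, e.p = p ∧ L (trunc b (G.len p) σ) e then (σ h.choose).p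
    else A (trunc b (G.len p) σ) p p, fun p => by
    dsimp only
    split_ifs with h
    · have := (unravelHom G k D).child (σ.child h.choose)
      rwa [show unravelHom G k D h.choose = p from h.choose_spec.1] at this
    · exact Strat.child _ _⟩

variable {L : (UPos G k D → UPos G k D) → UPos G k D → Prop}
  {A : (UPos G k D → UPos G k D) → G.P → G.Strat}

lemma pushforward_of_lift {b : ℕ} {σ : (unravel G k D).Strat} {e : UPos G k D}
    (hL : L (trunc b (G.len e.p) σ) e)
    (huniq : ∀ e', e'.p = e.p → L (trunc b (G.len e.p) σ) e' → e' = e) :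
    pushforward L A b σ e.p = (σ e).p := by
  have h : ∃ e' : UPos G k D, e'.p = e.p ∧ L (trunc b (G.len e.p) σ) e' := ⟨e, rfl, hL⟩
  simp only [pushforward, dif_pos h]
  rw [huniq _ h.choose_spec.1 h.choose_spec.2]

lemma pushforward_of_not_lift {b : ℕ} {σ : (unravel G k D).Strat} {p : G.P}
    (h : ¬ ∃ e : UPos G k D, e.p = p ∧ L (trunc b (G.len p) σ) e) :
    pushforward L A b σ p = A (trunc b (G.len p) σ) p p := by
  simp only [pushforward, dif_neg h]

lemma pushforward_loc (b : ℕ) (σ σ' : (unravel G k D).Strat) (n : ℕ)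
    (h : ∀ p, (unravel G k D).len p ≤ n → ((unravel G k D).len p + b) % 2 = 0 → σ p = σ' p)
    (p : G.P) (hp : G.len p ≤ n) (hb : (G.len p + b) % 2 = 0) :
    pushforward L A b σ p = pushforward L A b σ' p := by
  have ht : trunc b (G.len p) σ = trunc b (G.len p) σ' := by
    funext e
    simp only [trunc]
    split_ifs with he
    · exact h e (by omega) he.2
    · rfl
  by_cases h' : ∃ e : UPos G k D, e.p = p ∧ L (trunc b (G.len p) σ) e
  · have h'' : ∃ e : UPos G k D, e.p = p ∧ L (trunc b (G.len p) σ') e := ht ▸ h'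
    have hl : G.len h'.choose.p = G.len p := by rw [h'.choose_spec.1]
    have he : h'.choose = h''.choose := by congr 1; funext e; rw [ht]
    have hσ := h h'.choose (hl.le.trans hp) (by rw [← hl] at hb; exact hb)
    simp only [pushforward, dif_pos h', dif_pos h'']
    rw [hσ, he]
  · have h'' : ¬ ∃ e : UPos G k D, e.p = p ∧ L (trunc b (G.len p) σ') e := ht ▸ h'
    rw [pushforward_of_not_lift h', pushforward_of_not_lift h'', ht]

end Closed

end GameTree

namespace GameTree

section FirstPlayer

variable {G : GameTree} {k : ℕ} {D : Set G.P}

lemma len_tr_le (m : ℕ) (p : G.P) : G.len (G.tr m p) ≤ m := by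
  rw [tr, len_iter]; omega

lemma Child.force {b : ℕ} {U : Set G.P} {z z' : G.P} (h : G.Child z' z)
    (hb : (G.len z + b) % 2 = 0) (hz : ¬ Force b U z) : ¬ Force b U z' :=
  fun h' => hz (force_of_child hb h h')

/-- The offer made by a strategy of the first player. -/
def offerOf (g : UPos G k D → UPos G k D) (p : G.P) : Set G.P :=
  (g (unravelShort (G.tr k p) (len_tr_le k p))).S

/-- The members of `S` above `q` at and below which the first player cannot force `D` within
`S`. -/
def safe (b k : ℕ) (D S : Set G.P) (q : G.P) : Set G.P :=
  {z | z ∈ S ∧ k + 2 ≤ G.len z ∧ G.tr (k + 2) z = q ∧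
    ∀ m, k + 2 ≤ m → m ≤ G.len z → ¬ Force b (S ∩ D) (G.tr m z)}

/-- The positions of the auxiliary game which the pushforward of a strategy of the first player
takes into account. -/
def liftFirst (b : ℕ) (g : UPos G k D → UPos G k D) (e : UPos G k D) : Prop :=
  G.len e.p ≤ k ∨ (k + 1 < G.len e.p ∧ e.S = offerOf g e.p ∧
    ((e.b = false ∧ ∃ m, k + 2 ≤ m ∧ m ≤ G.len e.p ∧ G.tr m e.p ∈ e.S ∩ D ∧
        (∀ j, k + 2 ≤ j → j < m → G.tr j e.p ∉ e.S ∩ D) ∧ e.c = comparable (G.tr m e.p)) ∨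
      (e.b = true ∧ (∀ m, k + 2 ≤ m → m ≤ G.len e.p → ¬ Force b (e.S ∩ D) (G.tr m e.p)) ∧
        e.c = safe b k D e.S (G.tr (k + 2) e.p))))

lemma UPos.eq_of_short {e e' : UPos G k D} (hp : e'.p = e.p) (h : G.len e.p ≤ k) : e' = e :=
  UPos.ext_succ hp (fun h' => by rw [hp] at h'; omega) (fun h' => by rw [hp] at h'; omega)

lemma liftFirst_unique {b : ℕ} {g : UPos G k D → UPos G k D} {e e' : UPos G k D}
    (h : liftFirst b g e) (hp : e'.p = e.p) (h' : liftFirst b g e') : e' = e := by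
  rcases h with h | ⟨hl, hS, h⟩
  · exact UPos.eq_of_short hp h
  rcases h' with h' | ⟨-, hS', h'⟩
  · rw [hp] at h'; omega
  have hSS : e'.S = e.S := by rw [hS, hS', hp]
  rw [hSS, hp] at h'
  rcases h with ⟨hb, m, hm, hml, hmU, hmin, hc⟩ | ⟨hb, hF, hc⟩ <;>
    rcases h' with ⟨hb', m', hm', hml', hmU', hmin', hc'⟩ | ⟨hb', hF', hc'⟩
  · obtain rfl : m = m' := by
      rcases lt_trichotomy m m' with h | h | h
      · exact absurd hmU (hmin' m hm h)
      · exact h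
      · exact absurd hmU' (hmin m' hm' h)
    exact UPos.ext hp hSS (by rw [hb, hb']) (by rw [hc, hc'])
  · exact absurd (force_of_mem hmU) (hF' m hm hml)
  · exact absurd (force_of_mem hmU') (hF m' hm' hml')
  · exact UPos.ext hp hSS (by rw [hb, hb']) (by rw [hc, hc'])

/-- The pushforward of strategies of the first player. -/
noncomputable def pushFirst (b : ℕ) (σ : (unravel G k D).Strat) : G.Strat :=
  pushforward (liftFirst b) (fun g p => attract b (offerOf g p ∩ D) (k + 2)) b σ

lemma pushFirst_of_lift {b : ℕ} {σ : (unravel G k D).Strat} {e : UPos G k D}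
    (hL : liftFirst b (trunc b (G.len e.p) σ) e) : pushFirst b σ e.p = (σ e).p :=
  pushforward_of_lift hL fun _ hp h => liftFirst_unique hL hp h

lemma pushFirst_short {b : ℕ} {σ : (unravel G k D).Strat} {e : UPos G k D}
    (h : G.len e.p ≤ k) : pushFirst b σ e.p = (σ e).p :=
  pushFirst_of_lift (Or.inl h)

lemma offerOf_trunc {b n : ℕ} {σ : (unravel G k D).Strat} (hkb : (k + b) % 2 = 0) (hn : k ≤ n)
    {x : ℕ → G.P} (hx : G.IsPlay x) {j : ℕ} (hj : k ≤ j) :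
    offerOf (trunc b n σ) (x j) = (σ (unravelShort (x k) (hx.len k).le)).S := by
  have : ∀ z (h : G.len z ≤ k), z = x k →
      ((trunc b n σ : UPos G k D → UPos G k D) (unravelShort z h)).S
        = (σ (unravelShort (x k) (hx.len k).le)).S := by
    rintro z h rfl
    have hl : (unravel G k D).len (unravelShort (x k) h) = k := hx.len k
    exact congrArg UPos.S (trunc_apply (hl.le.trans hn) (by rw [hl]; exact hkb))
  exact this _ _ (hx.tr hj)

lemma pushFirst_lift {b : ℕ} (hk : k % 2 = 0) (hb : b % 2 = 0) (σ : (unravel G k D).Strat)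
    {x : ℕ → G.P} (hx : G.IsPlay x) (hcons : Cons b (pushFirst b σ) x) :
    ∃ x', (unravel G k D).IsPlay x' ∧ Cons b σ x' ∧ ∀ n, unravelHom G k D (x' n) = x n := by
  obtain ⟨e₀, he₀⟩ : ∃ e₀ : UPos G k D, e₀ = unravelShort (x k) (hx.len k).le := ⟨_, rfl⟩
  obtain ⟨S, hSe⟩ : ∃ S, S = (σ e₀).S := ⟨_, rfl⟩
  have hoff : ∀ n j, k ≤ n → k ≤ j → offerOf (trunc b n σ) (x j) = S := fun n j hn hj => by
    rw [offerOf_trunc (by omega) hn hx hj, hSe, he₀]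
  have he₀p : e₀.p = x k := by rw [he₀]; rfl
  have hσ₀ : (σ e₀).p = x (k + 1) := by
    rw [hcons k (by omega), ← he₀p, pushFirst_short (by rw [he₀p, hx.len])]
  have hS : IsOffer k (x (k + 1)) S := by
    have := (σ e₀).offer (by rw [hσ₀, hx.len]; omega)
    rwa [hσ₀, hx.tr le_rfl, ← hSe] at this
  have hshort : ∀ {c' : Bool} {c : Set G.P} (hc : IsAnswer k D S (x (k + 2)) c' c)
      (hm : ∀ n, k + 1 < n → x n ∈ c), ∀ n, (n + b) % 2 = 0 → n ≤ k →
      (σ (unravelPlay hx hS hc hm n)).p = x (n + 1) := fun hc hm n hn hnk => by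
    rw [hcons n hn, ← pushFirst_short (e := unravelPlay hx hS hc hm n) ((hx.len n).le.trans hnk)]
    rfl
  have hSk : ∀ {c' : Bool} {c : Set G.P} (hc : IsAnswer k D S (x (k + 2)) c' c)
      (hm : ∀ n, k + 1 < n → x n ∈ c), (σ (unravelPlay hx hS hc hm k)).S = S := fun hc hm => by
    refine Eq.trans ?_ hSe.symm
    rw [UPos.eq_of_short (e := e₀) (e' := unravelPlay hx hS hc hm k) he₀p.symm
      (by rw [he₀p, hx.len])]
  by_cases hA : ∃ m, k + 2 ≤ m ∧ x m ∈ S ∩ D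
  · classical
    obtain ⟨m, ⟨hm2, hmSD⟩, hmin⟩ :=
      (⟨Nat.find hA, Nat.find_spec hA, fun j hj => Nat.find_min hA hj⟩ :
      ∃ m, (k + 2 ≤ m ∧ x m ∈ S ∩ D) ∧ ∀ j, j < m → ¬ (k + 2 ≤ j ∧ x j ∈ S ∩ D))
    have hc : IsAnswer k D S (x (k + 2)) false (comparable (x m)) :=
      Or.inr ⟨rfl, x m, hmSD.1, hmSD.2, by rw [hx.len]; exact hm2, hx.tr hm2, rfl⟩
    have hm : ∀ n, k + 1 < n → x n ∈ comparable (x m) := fun n _ => hx.mem_comparable m n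
    refine ⟨unravelPlay hx hS hc hm, unravelPlay_isPlay hx hS hc hm,
      unravelPlay_cons hx hS hc hm (fun n hn => ?_) (fun _ => hSk hc hm) (fun h => by omega),
      fun n => rfl⟩
    rcases Nat.lt_or_ge k n with hkn | hkn
    · have hkn1 : k + 1 < n := by omega
      rcases Nat.lt_or_ge n m with hnm | hnm
      · exact unravelPlay_forced hx hS hc hm σ hkn1 hnm
      · rw [hcons n hn]
        refine (pushFirst_of_lift (e := unravelPlay hx hS hc hm n) (Or.inr ?_)).symm
        have hl : G.len (unravelPlay hx hS hc hm n).p = n := hx.len n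
        have hpp : (unravelPlay hx hS hc hm n).p = x n := rfl
        have hSS : (unravelPlay hx hS hc hm n).S = S := if_neg (by omega)
        have hbb : (unravelPlay hx hS hc hm n).b = false := if_neg (by omega)
        have hcc : (unravelPlay hx hS hc hm n).c = comparable (x m) := if_neg (by omega)
        rw [hl, hpp, hSS, hbb, hcc]
        refine ⟨hkn1, (hoff n n hkn.le hkn.le).symm, Or.inl ⟨rfl, m, hm2, hnm, ?_, ?_, ?_⟩⟩
        · rwa [hx.tr hnm]
        · intro j hj hjm
          rw [hx.tr (by omega)]
          exact fun h => hmin j hjm ⟨hj, h⟩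
        · rw [hx.tr hnm]
    · exact hshort hc hm n hn hkn
  · have hnF : ∀ m, k + 2 ≤ m → ¬ Force b (S ∩ D) (x m) := by
      intro m hm hF
      refine hA (attract_meets hx ⟨m, hm, hF⟩ fun n hn ⟨j, hj, hjn, hjF⟩ => ?_)
      rw [hcons n hn, pushFirst, pushforward_of_not_lift,
        hoff _ _ (by rw [hx.len]; omega) (by omega)]
      rintro ⟨e, hep, he⟩
      rcases he with he | ⟨-, hS', he⟩
      · rw [hep, hx.len] at he; omega
      rw [hep, hoff _ _ (by rw [hx.len]; omega) (by omega)] at hS'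
      rw [hep, hS', hx.len] at he
      rcases he with ⟨-, m, hm, hmn, hmU, -⟩ | ⟨-, hF', -⟩
      · rw [hx.tr hmn] at hmU
        exact hA ⟨m, hm, hmU⟩
      · refine hF' j hj hjn ?_
        rwa [hx.tr hjn]
    have hx2S : x (k + 2) ∈ S :=
      hS.opp _ hS.mem (by rw [hx.len]; omega) _ (hx.child (k + 1))
    have hsafe_child : ∀ z ∈ safe b k D S (x (k + 2)), ∀ z' ∈ S, G.Child z' z →
        ¬ Force b (S ∩ D) z' → z' ∈ safe b k D S (x (k + 2)) := by
      intro z hz z' hz'S hzz' hF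
      have hl := hzz'.2
      refine ⟨hz'S, by have := hz.2.1; omega, by rw [hzz'.tr_eq hz.2.1]; exact hz.2.2.1,
        fun m hm hml => ?_⟩
      rcases Nat.lt_or_ge (G.len z) m with h | h
      · rwa [tr_of_le (by omega)]
      · rw [hzz'.tr_eq h]; exact hz.2.2.2 m hm h
    have hsafe_last : ∀ z ∈ safe b k D S (x (k + 2)), ¬ Force b (S ∩ D) z := fun z hz => by
      have := hz.2.2.2 _ hz.2.1 le_rfl
      rwa [tr_of_le le_rfl] at this
    have hx2 : x (k + 2) ∈ safe b k D S (x (k + 2)) := by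
      refine ⟨hx2S, (hx.len _).ge, hx.tr le_rfl, fun m hm hml => ?_⟩
      rw [hx.len] at hml
      rw [hx.tr hml]; exact hnF m hm
    have hc : IsAnswer k D S (x (k + 2)) true (safe b k D S (x (k + 2))) := by
      refine Or.inl ⟨rfl, ⟨⟨fun z hz => ⟨hz.2.1, hz.2.2.1⟩, hx2, fun z hz hl => ?_, fun z hz => ?_⟩,
        fun z hz => hz.1, fun z hz hD => hsafe_last z hz (force_of_mem ⟨hz.1, hD⟩),
        fun z hz hl z' hz' hzz' => hsafe_child z hz z' hz' hzz'
          (hzz'.force (by omega) (hsafe_last z hz))⟩⟩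
      · refine ⟨hS.par z hz.1 (by omega), by rw [G.len_par]; omega,
          by rw [tr_par hl]; exact hz.2.2.1,
          fun m hm hml => ?_⟩
        rw [G.len_par] at hml
        rw [tr_par (by omega)]; exact hz.2.2.2 m hm (by omega)
      · rcases Nat.mod_two_eq_zero_or_one (G.len z) with h | h
        · obtain ⟨z', hz'S, hz'⟩ := hS.ext z hz.1
          exact ⟨z', hsafe_child z hz z' hz'S hz' (hz'.force (by omega) (hsafe_last z hz)), hz'⟩
        · obtain ⟨z', hz', hF⟩ := exists_child_not_force (hsafe_last z hz)
          exact ⟨z', hsafe_child z hz z' (hS.opp z hz.1 h z' hz') hz' hF, hz'⟩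
    have hlift : ∀ (n : ℕ) (e : UPos G k D), (n + b) % 2 = 0 → k + 2 ≤ n → e.p = x n → e.S = S →
        e.b = true → e.c = safe b k D S (x (k + 2)) → (σ e).p = x (n + 1) := by
      intro n e hn hkn hp hS' hb' hc'
      rw [hcons n hn, ← hp]
      refine (pushFirst_of_lift (Or.inr ?_)).symm
      rw [hS', hp, hb', hc', hx.len, hx.tr hkn]
      refine ⟨by omega, (hoff n n (by omega) (by omega)).symm,
        Or.inr ⟨rfl, fun m hm hml => ?_, rfl⟩⟩
      rw [hx.tr hml]; exact hnF m hm
    have hm : ∀ n, k + 2 ≤ n → x n ∈ safe b k D S (x (k + 2)) := by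
      intro n hn
      induction n, hn using Nat.le_induction with
      | base => exact hx2
      | succ n hn ih =>
        rcases Nat.mod_two_eq_zero_or_one n with h | h
        · obtain ⟨e, hp, hS', hb', hc'⟩ : ∃ e : UPos G k D, e.p = x n ∧ e.S = S ∧ e.b = true ∧
              e.c = safe b k D S (x (k + 2)) :=
            ⟨⟨x n, S, true, safe b k D S (x (k + 2)), fun h => by rw [hx.len] at h; omega,
              fun _ => by rw [hx.tr (by omega)]; exact hS, fun h => by rw [hx.len] at h; omega,
              fun _ => by rw [hx.tr hn]; exact hc, fun _ => ih⟩, rfl, rfl, rfl, rfl⟩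
          have hl := hlift n e (by omega) hn hp hS' hb' hc'
          have hmem := (σ e).mem (by rw [hl, hx.len]; omega)
          have h2 := (unravel_child (σ.child e)).2.2 (by rw [hp, hx.len]; omega)
          rwa [h2.2, hl, hc'] at hmem
        · exact hsafe_child _ ih _ (hS.opp _ ih.1 (by rwa [hx.len]) _ (hx.child n)) (hx.child n)
            (hnF _ (by omega))
    have hm' : ∀ n, k + 1 < n → x n ∈ safe b k D S (x (k + 2)) := fun n hn => hm n hn
    refine ⟨unravelPlay hx hS hc hm', unravelPlay_isPlay hx hS hc hm',
      unravelPlay_cons hx hS hc hm' (fun n hn => ?_) (fun _ => hSk hc hm') (fun h => by omega),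
      fun n => rfl⟩
    rcases Nat.lt_or_ge k n with hkn | hkn
    · exact hlift n _ hn (by omega) rfl (if_neg (by omega)) (if_neg (by omega)) (if_neg (by omega))
    · exact hshort hc hm' n hn hkn

end FirstPlayer

end GameTree

namespace GameTree

section SecondPlayer

variable {G : GameTree} {k : ℕ} {D : Set G.P}

/-- The position `u` is used to reject the offer `S`. -/
def rejects (g : UPos G k D → UPos G k D) (u : G.P) (S : Set G.P) : Prop :=
  ∃ e : UPos G k D, G.len e.p = k + 1 ∧ e.p = G.tr (k + 1) u ∧ e.S = S ∧ k + 2 ≤ G.len u ∧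
    u ∈ S ∧ u ∈ D ∧ (g e).p = G.tr (k + 2) u ∧ (g e).b = false ∧ (g e).c = comparable u

/-- The positions used to reject some offer. -/
def rejectSet (g : UPos G k D → UPos G k D) : Set G.P := {u | ∃ S, rejects g u S}

open Classical in
/-- An offer related to `u` by `r`. -/
noncomputable def witness (r : G.P → Set G.P → Prop) (u : G.P) : Set G.P :=
  if h : ∃ S, r u S then h.choose else ∅

/-- The extensions of `q` at and below which `U` cannot be forced. -/
def stay (b k : ℕ) (U : Set G.P) (q : G.P) : Set G.P :=
  {z | k + 1 ≤ G.len z ∧ G.tr (k + 1) z = q ∧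
    ∀ m, k + 1 ≤ m → m ≤ G.len z → ¬ Force b U (G.tr m z)}

/-- The positions of the auxiliary game which the pushforward of a strategy of the second player
takes into account. -/
def liftSecond (b : ℕ) (g : UPos G k D → UPos G k D) (e : UPos G k D) : Prop :=
  G.len e.p ≤ k ∨ (k < G.len e.p ∧
    ((e.b = false ∧ ∃ m, k + 2 ≤ m ∧ m ≤ G.len e.p ∧ G.tr m e.p ∈ rejectSet g ∧
        (∀ j, j < m → G.tr j e.p ∉ rejectSet g) ∧ e.c = comparable (G.tr m e.p) ∧
        e.S = witness (rejects g) (G.tr m e.p)) ∨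
      ((∀ m, k + 1 ≤ m → m ≤ G.len e.p → ¬ Force b (rejectSet g) (G.tr m e.p)) ∧
        e.S = stay b k (rejectSet g) (G.tr (k + 1) e.p) ∧
        (k + 1 < G.len e.p → ∃ e₁ : UPos G k D, G.len e₁.p = k + 1 ∧ e₁.p = G.tr (k + 1) e.p ∧
          e₁.S = stay b k (rejectSet g) (G.tr (k + 1) e.p) ∧
          e.b = (g e₁).b ∧ e.c = (g e₁).c))))

lemma liftSecond_unique {b : ℕ} {g : UPos G k D → UPos G k D} {e e' : UPos G k D}
    (h : liftSecond b g e) (hp : e'.p = e.p) (h' : liftSecond b g e') : e' = e := by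
  rcases h with h | ⟨hl, h⟩
  · exact UPos.eq_of_short hp h
  rcases h' with h' | ⟨-, h'⟩
  · rw [hp] at h'; omega
  rw [hp] at h'
  rcases h with ⟨hb, m, hm, hml, hmU, hmin, hc, hS⟩ | ⟨hF, hS, h⟩ <;>
    rcases h' with ⟨hb', m', hm', hml', hmU', hmin', hc', hS'⟩ | ⟨hF', hS', h'⟩
  · obtain rfl : m = m' := by
      rcases lt_trichotomy m m' with h | h | h
      · exact absurd hmU (hmin' m h)
      · exact h
      · exact absurd hmU' (hmin m' h)
    exact UPos.ext hp (by rw [hS, hS']) (by rw [hb, hb']) (by rw [hc, hc'])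
  · exact absurd (force_of_mem hmU) (hF' m (by omega) hml)
  · exact absurd (force_of_mem hmU') (hF m' (by omega) hml')
  · refine UPos.ext_succ hp (fun _ => by rw [hS, hS']) fun hl => ?_
    rw [hp] at hl
    obtain ⟨e₁, hl₁, hp₁, hS₁, hb₁, hc₁⟩ := h hl
    obtain ⟨e₂, hl₂, hp₂, hS₂, hb₂, hc₂⟩ := h' hl
    obtain rfl : e₁ = e₂ := UPos.ext_succ (by rw [hp₁, hp₂]) (fun _ => by rw [hS₁, hS₂])
      fun h => by omega
    exact ⟨by rw [hb₁, hb₂], by rw [hc₁, hc₂]⟩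

/-- The pushforward of strategies of the second player. -/
noncomputable def pushSecond (b : ℕ) (σ : (unravel G k D).Strat) : G.Strat :=
  pushforward (liftSecond b) (fun g _ => attract b (rejectSet g) (k + 1)) b σ

lemma pushSecond_of_lift {b : ℕ} {σ : (unravel G k D).Strat} {e : UPos G k D}
    (hL : liftSecond b (trunc b (G.len e.p) σ) e) : pushSecond b σ e.p = (σ e).p :=
  pushforward_of_lift hL fun _ hp h => liftSecond_unique hL hp h

lemma pushSecond_short {b : ℕ} {σ : (unravel G k D).Strat} {e : UPos G k D}
    (h : G.len e.p ≤ k) : pushSecond b σ e.p = (σ e).p :=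
  pushSecond_of_lift (Or.inl h)

lemma trunc_unravel {b n : ℕ} {σ : (unravel G k D).Strat} (hkb : (k + 1 + b) % 2 = 0)
    (hn : k + 1 ≤ n) {e : UPos G k D} (he : G.len e.p = k + 1) :
    (trunc b n σ : UPos G k D → UPos G k D) e = σ e :=
  trunc_apply (G := unravel G k D) (p := e) (he.le.trans hn) (by
    change (G.len e.p + b) % 2 = 0
    rw [he]; exact hkb)

lemma rejects_trunc {b n : ℕ} {σ : (unravel G k D).Strat} (hkb : (k + 1 + b) % 2 = 0)
    (hn : k + 1 ≤ n) : rejects (trunc b n σ : UPos G k D → UPos G k D) = rejects σ := by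
  funext u S
  refine propext ⟨?_, ?_⟩
  · rintro ⟨e, hl, h⟩
    rw [trunc_unravel hkb hn hl] at h
    exact ⟨e, hl, h⟩
  · rintro ⟨e, hl, h⟩
    rw [← trunc_unravel hkb hn hl] at h
    exact ⟨e, hl, h⟩

lemma pushSecond_lift {b : ℕ} (hk : k % 2 = 0) (hb : b % 2 = 1) (σ : (unravel G k D).Strat)
    {x : ℕ → G.P} (hx : G.IsPlay x) (hcons : Cons b (pushSecond b σ) x) :
    ∃ x', (unravel G k D).IsPlay x' ∧ Cons b σ x' ∧ ∀ n, unravelHom G k D (x' n) = x n := by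
  have hkb : (k + 1 + b) % 2 = 0 := by omega
  obtain ⟨U, hU⟩ : ∃ U, U = rejectSet (σ : UPos G k D → UPos G k D) := ⟨_, rfl⟩
  have hUt : ∀ n, k + 1 ≤ n → rejectSet (trunc b n σ : UPos G k D → UPos G k D) = U := by
    intro n hn
    change {u | ∃ S, rejects (trunc b n σ : UPos G k D → UPos G k D) u S} = U
    rw [rejects_trunc hkb hn, hU]; rfl
  have hshort : ∀ {S : Set G.P} (hS : IsOffer k (x (k + 1)) S) {c' : Bool} {c : Set G.P}
      (hc : IsAnswer k D S (x (k + 2)) c' c)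
      (hm : ∀ n, k + 1 < n → x n ∈ c), ∀ n, (n + b) % 2 = 0 → n ≤ k →
      (σ (unravelPlay hx hS hc hm n)).p = x (n + 1) := fun hS _ _ hc hm n hn hnk => by
    rw [hcons n hn, ← pushSecond_short (e := unravelPlay hx hS hc hm n) ((hx.len n).le.trans hnk)]
    rfl
  have hoffer : ∀ {S : Set G.P} (hS : IsOffer k (x (k + 1)) S) {c' : Bool} {c : Set G.P}
      (hc : IsAnswer k D S (x (k + 2)) c' c) (hm : ∀ n, k + 1 < n → x n ∈ c) (e : UPos G k D),
      e.p = x (k + 1) → e.S = S → unravelPlay hx hS hc hm (k + 1) = e := by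
    intro S hS c' c hc hm e hp hSe
    exact UPos.ext_succ hp.symm (fun _ => (if_neg (by omega)).trans hSe.symm) fun h => by
      change k + 1 < G.len (x (k + 1)) at h
      rw [hx.len] at h; omega
  by_cases hA : ∃ m, x m ∈ U
  · classical
    obtain ⟨m, hmU, hmin⟩ := (⟨Nat.find hA, Nat.find_spec hA, fun j hj => Nat.find_min hA hj⟩ :
      ∃ m, x m ∈ U ∧ ∀ j, j < m → x j ∉ U)
    obtain ⟨S, hSw⟩ : ∃ S, S = witness (rejects (σ : UPos G k D → UPos G k D)) (x m) := ⟨_, rfl⟩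
    have hrej : rejects (σ : UPos G k D → UPos G k D) (x m) S := by
      rw [hU] at hmU
      have h : ∃ S, rejects (σ : UPos G k D → UPos G k D) (x m) S := hmU
      rw [hSw, witness, dif_pos h]
      exact h.choose_spec
    obtain ⟨e, hel, hep, heS, hm2, hmS, hmD, hσp, hσb, hσc⟩ := hrej
    rw [hx.len] at hm2
    rw [hx.tr (by omega)] at hep hσp
    have hS : IsOffer k (x (k + 1)) S := by
      have := e.offer (by omega)
      rwa [hep, hx.tr le_rfl, heS] at this
    have hc : IsAnswer k D S (x (k + 2)) false (comparable (x m)) :=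
      Or.inr ⟨rfl, x m, hmS, hmD, by rw [hx.len]; exact hm2, hx.tr hm2, rfl⟩
    have hm : ∀ n, k + 1 < n → x n ∈ comparable (x m) := fun n _ => hx.mem_comparable m n
    have he := hoffer hS hc hm e hep heS
    refine ⟨unravelPlay hx hS hc hm, unravelPlay_isPlay hx hS hc hm,
      unravelPlay_cons hx hS hc hm (fun n hn => ?_) (fun h => by omega)
        (fun _ => by rw [he]; exact ⟨hσb, hσc⟩), fun n => rfl⟩
    rcases Nat.lt_or_ge k n with hkn | hkn
    · rcases Nat.lt_or_ge (k + 1) n with hkn1 | hkn1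
      · rcases Nat.lt_or_ge n m with hnm | hnm
        · exact unravelPlay_forced hx hS hc hm σ hkn1 hnm
        · rw [hcons n hn]
          refine (pushSecond_of_lift (e := unravelPlay hx hS hc hm n) (Or.inr ?_)).symm
          have hl : G.len (unravelPlay hx hS hc hm n).p = n := hx.len n
          have hpp : (unravelPlay hx hS hc hm n).p = x n := rfl
          have hSS : (unravelPlay hx hS hc hm n).S = S := if_neg (by omega)
          have hbb : (unravelPlay hx hS hc hm n).b = false := if_neg (by omega)
          have hcc : (unravelPlay hx hS hc hm n).c = comparable (x m) := if_neg (by omega)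
          rw [hl, hUt n (by omega), rejects_trunc hkb (by omega), hpp, hSS, hbb, hcc]
          refine ⟨hkn, Or.inl ⟨rfl, m, hm2, hnm, ?_, ?_, ?_, ?_⟩⟩
          · rwa [hx.tr hnm]
          · intro j hj
            rw [hx.tr (by omega)]
            exact hmin j hj
          · rw [hx.tr hnm]
          · rw [hx.tr hnm, hSw]
      · obtain rfl : n = k + 1 := by omega
        rw [he, hσp]
    · exact hshort hS hc hm n hn hkn
  · have hnF : ∀ m, k + 1 ≤ m → ¬ Force b U (x m) := by
      intro m hm hF
      refine hA (Exists.imp (fun _ h => h.2) (attract_meets hx ⟨m, hm, hF⟩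
        fun n hn ⟨j, hj, hjn, hjF⟩ => ?_))
      rw [hcons n hn, pushSecond, pushforward_of_not_lift, hUt _ (by rw [hx.len]; omega)]
      rintro ⟨e, hep, he⟩
      rcases he with he | ⟨-, he⟩
      · rw [hep, hx.len] at he; omega
      rw [hep, hUt _ (by rw [hx.len]; omega), hx.len] at he
      rcases he with ⟨-, m, hm, hmn, hmU, -⟩ | ⟨hF', -⟩
      · rw [hx.tr hmn] at hmU
        exact hA ⟨m, hmU⟩
      · refine hF' j hj hjn ?_
        rwa [hx.tr hjn]
    obtain ⟨S, hSdef⟩ : ∃ S, S = stay b k U (x (k + 1)) := ⟨_, rfl⟩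
    have hxS : ∀ n, k + 1 ≤ n → x n ∈ S := by
      intro n hn
      rw [hSdef]
      refine ⟨by rwa [hx.len], hx.tr hn, fun m hm hml => ?_⟩
      rw [hx.len] at hml
      rw [hx.tr hml]; exact hnF m hm
    have hlast : ∀ z ∈ S, ¬ Force b U z := fun z hz => by
      rw [hSdef] at hz
      have := hz.2.2 _ hz.1 le_rfl
      rwa [tr_of_le le_rfl] at this
    have hchild : ∀ z ∈ S, ∀ z', G.Child z' z → ¬ Force b U z' → z' ∈ S := by
      intro z hz z' hzz' hF
      rw [hSdef] at hz ⊢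
      have hl := hzz'.2
      refine ⟨by have := hz.1; omega, by rw [hzz'.tr_eq hz.1]; exact hz.2.1, fun m hm hml => ?_⟩
      rcases Nat.lt_or_ge (G.len z) m with h | h
      · rwa [tr_of_le (by omega)]
      · rw [hzz'.tr_eq h]; exact hz.2.2 m hm h
    have hS : IsOffer k (x (k + 1)) S := by
      refine ⟨⟨fun z hz => ?_, hxS _ le_rfl, fun z hz hl => ?_, fun z hz => ?_⟩,
        fun z hz hl z' hz' => hchild z hz z' hz' (hz'.force (by omega) (hlast z hz))⟩
      · rw [hSdef] at hz; exact ⟨hz.1, hz.2.1⟩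
      · rw [hSdef] at hz ⊢
        refine ⟨by rw [G.len_par]; omega, by rw [tr_par hl]; exact hz.2.1, fun m hm hml => ?_⟩
        rw [G.len_par] at hml
        rw [tr_par (by omega)]; exact hz.2.2 m hm (by omega)
      · obtain ⟨z', hz', hF⟩ := exists_child_not_force (hlast z hz)
        exact ⟨z', hchild z hz z' hz' hF, hz'⟩
    obtain ⟨e₁, hp₁, hS₁⟩ : ∃ e : UPos G k D, e.p = x (k + 1) ∧ e.S = S :=
      ⟨⟨x (k + 1), S, false, ∅, fun h => by rw [hx.len] at h; omega,
        fun _ => by rw [hx.tr le_rfl]; exact hS, fun _ => ⟨rfl, rfl⟩,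
        fun h => by rw [hx.len] at h; omega, fun h => by rw [hx.len] at h; omega⟩, rfl, rfl⟩
    have hl₁ : G.len e₁.p = k + 1 := by rw [hp₁, hx.len]
    have hlift : ∀ (n : ℕ) (e : UPos G k D), (n + b) % 2 = 0 → k + 1 ≤ n → e.p = x n → e.S = S →
        (k + 1 < n → e.b = (σ e₁).b ∧ e.c = (σ e₁).c) → (σ e).p = x (n + 1) := by
      intro n e hn hkn hp hS' hbc
      rw [hcons n hn, ← hp]
      refine (pushSecond_of_lift (Or.inr ?_)).symm
      rw [hS', hp, hx.len, hUt n hkn, hx.tr hkn]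
      refine ⟨by omega, Or.inr ⟨fun m hm hml => ?_, hSdef, fun h => ⟨e₁, hl₁, hp₁, ?_, ?_⟩⟩⟩
      · rw [hx.tr hml]; exact hnF m hm
      · rw [hS₁, hSdef]
      · rw [trunc_unravel hkb hkn hl₁]; exact hbc h
    have hσ₁ : (σ e₁).p = x (k + 2) := hlift (k + 1) e₁ hkb le_rfl hp₁ hS₁ fun h => by omega
    obtain ⟨c, hcdef⟩ : ∃ c, c = (σ e₁).c := ⟨_, rfl⟩
    have hans := (σ e₁).answer (by rw [hσ₁, hx.len]; omega)
    rw [hσ₁, hx.tr le_rfl, (unravel_child (σ.child e₁)).2.1 (by omega), hS₁, ← hcdef] at hans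
    have hx2c : x (k + 2) ∈ c := by
      have := (σ e₁).mem (by rw [hσ₁, hx.len]; omega)
      rwa [hσ₁, ← hcdef] at this
    rcases hans with ⟨htrue, hr⟩ | ⟨hfalse, u, huS, huD, hul, hu2, huc⟩
    swap
    · refine absurd (force_of_mem ?_) (hlast u huS)
      rw [hU]
      refine ⟨S, e₁, hl₁, ?_, hS₁, hul, huS, huD, by rw [hu2]; exact hσ₁, hfalse,
        by rw [← hcdef, huc]⟩
      rw [hp₁]
      rw [hSdef] at huS
      exact huS.2.1.symm
    have hc : IsAnswer k D S (x (k + 2)) true c := Or.inl ⟨rfl, hr⟩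
    have hm : ∀ n, k + 2 ≤ n → x n ∈ c := by
      intro n hn
      induction n, hn using Nat.le_induction with
      | base => exact hx2c
      | succ n hn ih =>
        rcases Nat.mod_two_eq_zero_or_one n with h | h
        · exact hr.opp _ ih (by rwa [hx.len]) _ (hxS _ (by omega)) (hx.child n)
        · obtain ⟨e, hp, hS', hb', hc'⟩ : ∃ e : UPos G k D, e.p = x n ∧ e.S = S ∧ e.b = true ∧
              e.c = c :=
            ⟨⟨x n, S, true, c, fun h => by rw [hx.len] at h; omega,
              fun _ => by rw [hx.tr (by omega)]; exact hS, fun h => by rw [hx.len] at h; omega,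
              fun _ => by rw [hx.tr hn]; exact hc, fun _ => ih⟩, rfl, rfl, rfl, rfl⟩
          have hl := hlift n e (by omega) (by omega) hp hS'
            fun _ => ⟨hb'.trans htrue.symm, hc'.trans hcdef⟩
          have hmem := (σ e).mem (by rw [hl, hx.len]; omega)
          have h2 := (unravel_child (σ.child e)).2.2 (by rw [hp, hx.len]; omega)
          rwa [h2.2, hl, hc'] at hmem
    have hm' : ∀ n, k + 1 < n → x n ∈ c := fun n hn => hm n hn
    have he := hoffer hS hc hm' e₁ hp₁ hS₁
    refine ⟨unravelPlay hx hS hc hm', unravelPlay_isPlay hx hS hc hm',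
      unravelPlay_cons hx hS hc hm' (fun n hn => ?_) (fun h => by omega)
        (fun _ => by rw [he]; exact ⟨htrue, hcdef.symm⟩), fun n => rfl⟩
    rcases Nat.lt_or_ge k n with hkn | hkn
    · exact hlift n _ hn (by omega) rfl (if_neg (by omega)) fun h =>
        ⟨(if_neg (by omega)).trans htrue.symm, (if_neg (by omega)).trans hcdef⟩
    · exact hshort hS hc hm' n hn hkn

end SecondPlayer

section Unravel

variable {G : GameTree} {k : ℕ} {D : Set G.P}

/-- The auxiliary game covers the original one. -/
noncomputable def unravelCover (G : GameTree) {k : ℕ} (hk : k % 2 = 0) (D : Set G.P) :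
    Cover k (unravel G k D) G :=
  { unravelHom G k D with
    φ := fun b σ => if b % 2 = 0 then pushFirst b σ else pushSecond b σ
    loc := fun b σ σ' n h p hp hb => by
      split_ifs
      · exact pushforward_loc b σ σ' n h p hp hb
      · exact pushforward_loc b σ σ' n h p hp hb
    lift := fun b σ x hx hc => by
      rcases Nat.mod_two_eq_zero_or_one b with h | h
      · rw [if_pos h] at hc; exact pushFirst_lift hk h σ hx hc
      · rw [if_neg (by omega)] at hc; exact pushSecond_lift hk h σ hx hc
    inj := fun p q hp h => UPos.eq_of_short h ((show G.len q.p = G.len p.p by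
      exact congrArg G.len h.symm).trans_le hp)
    surj := fun p hp => ⟨unravelShort p hp, rfl⟩
    fix := fun b σ p hp hb => by
      split_ifs
      · exact pushFirst_short hp.le
      · exact pushSecond_short hp.le }

lemma levelDet_unravel {k : ℕ} {D : Set G.P} (hD : ∀ p q, G.Child q p → p ∈ D → q ∈ D)
    (hk : k % 2 = 0) :
    LevelDet (unravel G k D) {x | ∀ n, unravelCover G hk D (x n) ∉ D} := by
  refine ⟨k + 2, {e : UPos G k D | e.b = true}, fun x hx => ?_⟩
  have hxG : G.IsPlay fun n => (x n : UPos G k D).p := (unravelHom G k D).isPlay hx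
  have hlen : ∀ n, G.len (x n : UPos G k D).p = n := hxG.len
  have hbc : ∀ n, k + 2 ≤ n → UPos.b (x n) = UPos.b (x (k + 2)) ∧
      UPos.c (x n) = UPos.c (x (k + 2)) := by
    intro n hn
    induction n, hn using Nat.le_induction with
    | base => exact ⟨rfl, rfl⟩
    | succ n hn ih =>
      have := (unravel_child (hx.child n)).2.2 (by rw [hlen]; omega)
      exact ⟨this.1.trans ih.1, this.2.trans ih.2⟩
  have hDup : ∀ m n, m ≤ n → UPos.p (x m) ∈ D → UPos.p (x n) ∈ D := by
    intro m n hmn hm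
    induction n, hmn using Nat.le_induction with
    | base => exact hm
    | succ n hn ih => exact hD _ _ (hxG.child n) ih
  have hmem : ∀ n, k + 2 ≤ n → UPos.p (x n) ∈ UPos.c (x (k + 2)) := fun n hn => by
    rw [← (hbc n hn).2]
    exact UPos.mem (x n) (by rw [hlen]; omega)
  have hans := UPos.answer (x (k + 2)) (by rw [hlen]; omega)
  change (∀ n, UPos.p (x n) ∉ D) ↔ UPos.b (x (k + 2)) = true
  rcases hans with ⟨hb, hr⟩ | ⟨hb, u, huS, huD, hul, hu2, huc⟩
  · refine ⟨fun _ => hb, fun _ n hn => ?_⟩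
    exact hr.avoid _ (hmem (max n (k + 2)) (le_max_right _ _)) (hDup n _ (le_max_left _ _) hn)
  · refine ⟨fun h => absurd ?_ (h (G.len u)), fun h => by rw [hb] at h; cases h⟩
    have := hmem _ hul
    rw [huc] at this
    rwa [eq_of_mem_comparable this (hlen _)]

end Unravel

end GameTree

namespace GameTree

section Determinacy

variable {G : GameTree}

/-- Every game over `G` has a covering in which the payoff set `X` is decided at a finite level. -/
def Unravelable (X : Set (ℕ → G.P)) : Prop :=
  ∀ (k : ℕ) (G' : GameTree) (f : Hom G' G), ∃ (G'' : GameTree) (C : Cover k G'' G'),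
    LevelDet G'' {x | (fun n => f (C (x n))) ∈ X}

lemma Unravelable.iUnion {X : ℕ → Set (ℕ → G.P)} (h : ∀ i, Unravelable (X i)) :
    Unravelable (⋃ i, X i) := by
  intro k G' f
  choose N C hL using h
  let s : ℕ → Σ H : GameTree, Hom H G' := fun m => Nat.rec ⟨G', Hom.id G'⟩
    (fun m s => ⟨N m (k + m) s.1 (f.comp s.2), s.2.comp (C m (k + m) s.1 (f.comp s.2)).toHom⟩) m
  let T : Tower (fun m => (s m).1) k :=
    ⟨fun m => k + m, fun m => le_rfl, fun m => C m (k + m) (s m).1 (f.comp (s m).2)⟩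
  have hproj : ∀ m (e : T.lim.P), (s m).2 (T.proj m e) = T.proj 0 e := by
    intro m e
    induction m with
    | zero => rfl
    | succ m ih =>
      rw [← ih]
      change (s m).2 (T.C m (e.1 (m + 1))) = (s m).2 (e.1 m)
      rw [e.2 m]
  have hdet : ∀ i, ∃ (l : ℕ) (E : Set T.lim.P), ∀ x, T.lim.IsPlay x →
      ((fun n => f (T.proj 0 (x n))) ∈ X i ↔ x l ∈ E) := by
    intro i
    obtain ⟨l, E, hE⟩ := hL i (k + i) (s i).1 (f.comp (s i).2)
    refine ⟨l, {e | T.proj (i + 1) e ∈ E}, fun x hx => ?_⟩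
    refine Iff.trans (Eq.to_iff ?_) (hE _ ((T.proj (i + 1)).isPlay hx))
    refine congrArg (· ∈ X i) (funext fun n => ?_)
    rw [← hproj (i + 1)]
    rfl
  choose l E hE using hdet
  let D : Set T.lim.P := {p | ∃ i, l i ≤ T.lim.len p ∧ T.lim.tr (l i) p ∈ E i}
  have hD : ∀ p q, T.lim.Child q p → p ∈ D → q ∈ D := by
    rintro p q hq ⟨i, hi, hp⟩
    exact ⟨i, by have := hq.2; omega, by rwa [hq.tr_eq hi]⟩
  have hk : 2 * k % 2 = 0 := by omega
  refine ⟨unravel T.lim (2 * k) D,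
    T.cover.comp ((unravelCover T.lim hk D).mono (by omega)), ?_⟩
  obtain ⟨m, F, hF⟩ := levelDet_unravel hD hk
  refine ⟨m, Fᶜ, fun x hx => ?_⟩
  have hy := (unravelCover T.lim hk D).isPlay hx
  have h1 : (fun n => f (T.proj 0 (unravelCover T.lim hk D (x n)))) ∈ ⋃ i, X i ↔
      ¬ x m ∈ F := by
    rw [← hF x hx, Set.mem_iUnion]
    simp only [Set.mem_ofPred_eq, not_forall, not_not]
    constructor
    · rintro ⟨i, hi⟩
      refine ⟨l i, i, (hy.len _).ge, ?_⟩
      rw [hy.tr le_rfl]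
      exact (hE i _ hy).1 hi
    · rintro ⟨n, i, hi, hi'⟩
      rw [hy.len] at hi
      rw [hy.tr hi] at hi'
      exact ⟨i, (hE i _ hy).2 hi'⟩
  exact h1

/-- The σ-algebra of unravelable sets. -/
@[reducible]
def unravelableSpace (G : GameTree) : MeasurableSpace (ℕ → G.P) where
  MeasurableSet' := Unravelable
  measurableSet_empty := fun k G' _ =>
    ⟨G', Cover.id k G', 0, ∅, fun _ _ => Iff.rfl⟩
  measurableSet_compl := fun X hX k G' f => by
    obtain ⟨G'', C, m, E, hE⟩ := hX k G' f
    exact ⟨G'', C, m, Eᶜ, fun x hx => not_congr (hE x hx)⟩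
  measurableSet_iUnion := fun _ h => Unravelable.iUnion h

lemma unravelable_of_measurableSet {X : Set (ℕ → G.P)}
    (hX : @MeasurableSet _ (@MeasurableSpace.pi ℕ (fun _ => G.P) fun _ => ⊤) X) :
    Unravelable X := by
  have h : @MeasurableSpace.pi ℕ (fun _ => G.P) (fun _ => ⊤) ≤ unravelableSpace G := by
    refine iSup_le fun n => ?_
    rintro _ ⟨t, -, rfl⟩ k G' f
    exact ⟨G', Cover.id k G', n, {p | f p ∈ t}, fun _ _ => Iff.rfl⟩
  exact h X hX

open Classical in
/-- Borel determinacy. -/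
theorem determined {X : Set (ℕ → G.P)}
    (hX : @MeasurableSet _ (@MeasurableSpace.pi ℕ (fun _ => G.P) fun _ => ⊤) X) {p : G.P}
    (hp : G.len p = 0) :
    (∃ σ : G.Strat, ∀ x, G.IsPlay x → x 0 = p → Cons 0 σ x → x ∈ X) ∨
      ∃ σ : G.Strat, ∀ x, G.IsPlay x → x 0 = p → Cons 1 σ x → x ∉ X := by
  obtain ⟨G', C, m, E, hE⟩ := unravelable_of_measurableSet hX 0 G (Hom.id G)
  obtain ⟨e, he⟩ := C.surj p hp.le
  have hel : G'.len e = 0 := by rw [← C.len_eq]; exact (congrArg G.len he).trans hp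
  let U : Set G'.P := {q | G'.len q = m ∧ q ∈ E}
  have hroot : ∀ {x : ℕ → G.P} {x' : ℕ → G'.P}, G'.IsPlay x' → x 0 = p →
      (∀ n, C (x' n) = x n) → x' 0 = e := fun hx' h0 hxx' =>
    C.inj _ _ (hx'.len 0).le ((hxx' 0).trans (h0.trans he.symm))
  have hmem : ∀ {x : ℕ → G.P} {x' : ℕ → G'.P}, G'.IsPlay x' → (∀ n, C (x' n) = x n) →
      (x ∈ X ↔ x' m ∈ E) := fun {x x'} hx' hxx' => by
    rw [← hE x' hx']
    exact Eq.to_iff (congrArg (· ∈ X) (funext fun n => (hxx' n).symm))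
  by_cases hF : Force 0 U e
  · obtain ⟨ρ, hρ⟩ := hF
    refine Or.inl ⟨C.φ 0 ρ, fun x hx h0 hc => ?_⟩
    obtain ⟨x', hx', hc', hxx'⟩ := C.lift 0 ρ x hx hc
    obtain ⟨j, -, hjl, hjE⟩ := hρ x' hx' (by rw [hel]; exact hroot hx' h0 hxx')
      fun j _ hj => hc' j hj
    rw [hx'.len] at hjl
    rw [hmem hx' hxx', ← hjl]
    exact hjE
  · let τ : G'.Strat := ⟨fun q => if h : ¬ Force 0 U q then (exists_child_not_force h).choose
      else G'.someStrat q, fun q => by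
        dsimp only
        split_ifs with h
        · exact Strat.child _ _
        · exact (exists_child_not_force h).choose_spec.1⟩
    refine Or.inr ⟨C.φ 1 τ, fun x hx h0 hc hxX => ?_⟩
    obtain ⟨x', hx', hc', hxx'⟩ := C.lift 1 τ x hx hc
    have hn : ∀ n, ¬ Force 0 U (x' n) := by
      intro n
      induction n with
      | zero => rwa [hroot hx' h0 hxx']
      | succ n ih =>
        rcases Nat.mod_two_eq_zero_or_one n with h | h
        · exact (hx'.child n).force (by rw [hx'.len]; omega) ih
        · rw [hc' n (by omega)]
          change ¬ Force 0 U (dite _ _ _)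
          rw [dif_pos ih]
          exact (exists_child_not_force ih).choose_spec.2
    exact hn m (force_of_mem ⟨hx'.len m, (hmem hx' hxx').1 hxX⟩)

end Determinacy

end GameTree

section Games

variable {A : Type}

/-- The first `n` moves, latest first. -/
def history (a : ℕ → A) : ℕ → List A
  | 0 => []
  | n + 1 => a n :: history a n

/-- The tree of finite sequences. -/
def listTree (A : Type) [Inhabited A] : GameTree where
  P := List A
  len := List.length
  par := List.tail
  len_par p := List.length_tail
  par_zero p h := by rw [List.length_eq_zero_iff.1 h]; rfl
  ext p := ⟨default :: p, rfl, rfl⟩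

/-- Borel determinacy for games on a set of moves. -/
theorem game_determined [Inhabited A] {W : Set (ℕ → A)}
    (hW : @MeasurableSet _ (@MeasurableSpace.pi ℕ (fun _ => A) fun _ => ⊤) W) :
    (∃ σ : List A → A, ∀ a : ℕ → A, (∀ n, n % 2 = 0 → a n = σ (history a n)) → a ∈ W) ∨
      ∃ σ : List A → A, ∀ a : ℕ → A, (∀ n, n % 2 = 1 → a n = σ (history a n)) → a ∉ W := by
  let r : (ℕ → (listTree A).P) → ℕ → A := fun x n => List.headI (x (n + 1))
  have hr : @MeasurableSet _ (@MeasurableSpace.pi ℕ (fun _ => (listTree A).P) fun _ => ⊤)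
      (r ⁻¹' W) := by
    let _ : MeasurableSpace A := ⊤
    let _ : MeasurableSpace (listTree A).P := ⊤
    refine (measurable_pi_lambda r fun n => ?_) hW
    exact (measurable_from_top (f := fun l : (listTree A).P => List.headI l)).comp
      (measurable_pi_apply (n + 1))
  have hplay : ∀ a : ℕ → A, (listTree A).IsPlay (history a) := by
    intro a n
    refine ⟨?_, rfl⟩
    induction n with
    | zero => rfl
    | succ n ih => exact congrArg (· + 1) ih
  have hcons : ∀ (a : ℕ → A) (b : ℕ) (σ : (listTree A).Strat),
      (∀ n, (n + b) % 2 = 0 → a n = List.headI (σ (history a n))) →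
      GameTree.Cons b σ (history a) := by
    intro a b σ h n hn
    have h1 : List.tail (σ (history a n)) = history a n := σ.par _
    have h2 : List.length (σ (history a n)) = List.length (history a n) + 1 := σ.len _
    change a n :: history a n = σ (history a n)
    rw [h n hn]
    revert h1 h2
    generalize ((σ (history a n) : (listTree A).P) : List A) = l
    rintro h1 h2
    cases l with
    | nil => simp at h2
    | cons b l => simp only [List.tail_cons] at h1; rw [h1]; rfl
  rcases GameTree.determined hr (p := ([] : List A)) rfl with ⟨σ, hσ⟩ | ⟨σ, hσ⟩
  · refine Or.inl ⟨fun p => List.headI (σ p), fun a ha => ?_⟩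
    exact hσ (history a) (hplay a) rfl (hcons a 0 σ fun n hn => ha n (by omega))
  · refine Or.inr ⟨fun p => List.headI (σ p), fun a ha => ?_⟩
    exact hσ (history a) (hplay a) rfl (hcons a 1 σ fun n hn => ha n (by omega))

end Games

section Labelings

lemma exists_fixedPoint {α β : Type*} [Nonempty β] (r : α → ℕ) (F : (α → β) → α → β)
    (hF : ∀ x x' a, (∀ a', r a' < r a → x a' = x' a') → F x a = F x' a) : ∃ x, F x = x := by
  obtain ⟨b⟩ := ‹Nonempty β›
  let x₀ : α → β := fun _ => b
  have key : ∀ l a m m', r a < l → l ≤ m → l ≤ m' → F^[m] x₀ a = F^[m'] x₀ a := by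
    intro l
    induction l with
    | zero => intro a m m' h; omega
    | succ l ih =>
      intro a m m' h hm hm'
      obtain ⟨m, rfl⟩ := Nat.exists_eq_add_of_le' (show 1 ≤ m by omega)
      obtain ⟨m', rfl⟩ := Nat.exists_eq_add_of_le' (show 1 ≤ m' by omega)
      rw [Function.iterate_succ_apply', Function.iterate_succ_apply']
      exact hF _ _ _ fun a' ha' => ih a' m m' (by omega) (by omega) (by omega)
  refine ⟨fun a => F^[r a + 1] x₀ a, funext fun a => ?_⟩
  rw [hF _ (F^[r a] x₀) a fun a' ha' => key (r a' + 1) a' _ _ (by omega) le_rfl (by omega)]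
  rw [Function.iterate_succ_apply']

section Run

variable {A : Type}

/-- The history of the run in which the moves at stages of parity `b` follow `σ` and the other
moves are given by `g`. -/
def runHistory (b : ℕ) (σ : List A → A) (g : ℕ → A) : ℕ → List A
  | 0 => []
  | n + 1 => (if n % 2 = b then σ (runHistory b σ g n) else g (n / 2)) :: runHistory b σ g n

/-- The run in which the moves at stages of parity `b` follow `σ` and the other moves are
given by `g`. -/
def run (b : ℕ) (σ : List A → A) (g : ℕ → A) (n : ℕ) : A :=
  if n % 2 = b then σ (runHistory b σ g n) else g (n / 2)

lemma history_run (b : ℕ) (σ : List A → A) (g : ℕ → A) (n : ℕ) :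
    history (run b σ g) n = runHistory b σ g n := by
  induction n with
  | zero => rfl
  | succ n ih => rw [history, ih]; rfl

lemma runHistory_congr {b : ℕ} {σ : List A → A} {g g' : ℕ → A} {n : ℕ}
    (h : ∀ m < n, m % 2 ≠ b → g (m / 2) = g' (m / 2)) :
    runHistory b σ g n = runHistory b σ g' n := by
  induction n with
  | zero => rfl
  | succ n ih =>
    rw [runHistory, runHistory, ih fun m hm => h m (by omega)]
    split_ifs with hn
    · rfl
    · rw [h n (by omega) hn]

lemma run_congr {b : ℕ} {σ : List A → A} {g g' : ℕ → A} {n : ℕ} (hn : n % 2 = b)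
    (h : ∀ m < n, m % 2 ≠ b → g (m / 2) = g' (m / 2)) : run b σ g n = run b σ g' n := by
  rw [run, run, if_pos hn, if_pos hn, runHistory_congr h]

lemma run_follows (b : ℕ) (σ : List A → A) (g : ℕ → A) (n : ℕ) (hn : n % 2 = b) :
    run b σ g n = σ (history (run b σ g) n) := by
  rw [history_run, run, if_pos hn]

end Run

variable {n : ℕ}

/-- Modify the number `m` so as to differ from `p`. -/
def adjust (p m : ℕ) : ℕ := if m = p then m + 1 else m

lemma adjust_ne (p m : ℕ) : adjust p m ≠ p := by
  unfold adjust; split_ifs <;> omega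

lemma adjust_of_ne {p m : ℕ} (h : m ≠ p) : adjust p m = m := if_neg h

/-- The labelling of words with root label `k` and with raw labels `x`. -/
def lab {ι : Type} (k : ℕ) (x : List ι → ℕ) : List ι → ℕ
  | [] => k
  | j :: w => adjust (lab k x w) (x (j :: w))

lemma lab_congr {ι : Type} {k : ℕ} {x x' : List ι → ℕ} {l : ℕ}
    (h : ∀ v, v ≠ [] → v.length ≤ l → x v = x' v) : ∀ w, w.length ≤ l → lab k x w = lab k x' w
  | [], _ => rfl
  | j :: w, hw => by
    rw [lab, lab, lab_congr h w (by simp at hw; omega), h _ (by simp) hw]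

/-- The raw labels read off a run of the game where the first player is responsible for the words
ending in `i`. -/
def raw (i : Fin n) (a : ℕ → List (Fin n) → ℕ) (w : List (Fin n)) : ℕ :=
  if w.getLast? = some i then a (2 * (w.length - 1)) w else a (2 * (w.length - 1) + 1) w

/-- If the first player wins for all `i` with the same root label, then some labelling gets no
color. -/
lemma exists_lab_forall {k : ℕ} {P : Fin n → (List (Fin n) → ℕ) → Prop}
    (h : ∀ i, ∃ σ : List (List (Fin n) → ℕ) → List (Fin n) → ℕ, ∀ a : ℕ → List (Fin n) → ℕ,
      (∀ n, n % 2 = 0 → a n = σ (history a n)) → P i (lab k (raw i a))) :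
    ∃ y, ∀ i, P i y := by
  choose σ hσ using h
  let g : (List (Fin n) → ℕ) → ℕ → List (Fin n) → ℕ :=
    fun x s v => if v.length = s + 1 then x v else 0
  obtain ⟨x, hx⟩ := exists_fixedPoint List.length
    (fun (x : List (Fin n) → ℕ) w => match w.getLast? with
      | none => 0
      | some i => run 0 (σ i) (g x) (2 * (w.length - 1)) w) (by
    intro x x' w h
    cases hw : w.getLast? with
    | none => rfl
    | some i =>
      refine congrFun (run_congr (by omega) fun m hm hm2 => funext fun v => ?_) w
      change ite _ _ _ = ite _ _ _
      split_ifs with hv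
      · exact h v (by omega)
      · rfl)
  refine ⟨lab k x, fun i => ?_⟩
  convert hσ i (run 0 (σ i) (g x)) (fun m hm => run_follows 0 _ _ m hm) using 1
  funext w
  refine lab_congr (fun v hv _ => ?_) w le_rfl
  have hl := List.length_pos_iff.2 hv
  rw [raw]
  split_ifs with hi
  · conv_lhs => rw [← hx]
    simp only [hi]
  · rw [run, if_neg (by omega)]
    change _ = ite _ _ _
    rw [if_pos (by omega)]

/-- If the second player wins for `i` with two different root labels, then there are two labellings
related by `i` that both satisfy the second player. -/
lemma exists_lab_pair {i : Fin n} {k : Bool → ℕ} (hk : k true ≠ k false)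
    {P : (List (Fin n) → ℕ) → Prop}
    (h : ∀ b, ∃ τ : List (List (Fin n) → ℕ) → List (Fin n) → ℕ, ∀ a : ℕ → List (Fin n) → ℕ,
      (∀ n, n % 2 = 1 → a n = τ (history a n)) → P (lab (k b) (raw i a))) :
    ∃ x : Bool → List (Fin n) → ℕ, (∀ b, P (lab (k b) (x b))) ∧
      ∀ b u, lab (k b) (x b) (u ++ [i]) = lab (k !b) (x !b) u := by
  choose τ hτ using h
  let f : (Bool × List (Fin n) → ℕ) → Bool → ℕ → List (Fin n) → ℕ :=
    fun Z b s v => if v.length = s + 1 then lab (k !b) (fun u => Z (!b, u)) v.dropLast else 0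
  obtain ⟨Z, hZ⟩ := exists_fixedPoint (fun p : Bool × List (Fin n) => p.2.length)
    (fun Z p => if p.2 = [] then 0 else
      if p.2.getLast? = some i then lab (k !p.1) (fun u => Z (!p.1, u)) p.2.dropLast
      else run 1 (τ p.1) (f Z p.1) (2 * (p.2.length - 1) + 1) p.2) (by
    rintro Z Z' ⟨b, w⟩ h
    dsimp only at h ⊢
    split_ifs with h0 hi
    · rfl
    · have := List.length_pos_iff.2 h0
      exact lab_congr (l := w.length - 1) (fun v _ hv => h _ (by dsimp only; omega)) _ (by simp)
    · have := List.length_pos_iff.2 h0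
      refine congrFun (run_congr (by omega) fun m hm hm2 => funext fun v => ?_) w
      change ite _ _ _ = ite _ _ _
      split_ifs with hv
      · exact lab_congr (l := v.length - 1) (fun v _ hv => h _ (by dsimp only; omega)) _ (by simp)
      · rfl)
  have hlast : ∀ b u, Z (b, u ++ [i]) = lab (k !b) (fun u => Z (!b, u)) u := by
    intro b u
    conv_lhs => rw [← hZ]
    simp
  refine ⟨fun b u => Z (b, u), fun b => ?_, fun b u => ?_⟩
  · convert hτ b (run 1 (τ b) (f Z b)) (fun m hm => run_follows 1 _ _ m hm) using 1
    funext w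
    refine lab_congr (fun v hv _ => ?_) w le_rfl
    have hl := List.length_pos_iff.2 hv
    rw [raw]
    split_ifs with hi
    · rw [run, if_neg (by omega)]
      change _ = ite _ _ _
      rw [if_pos (by omega), ← hlast, List.dropLast_append_getLast? _ hi]
    · conv_lhs => rw [← hZ]
      simp only [hv, hi, if_false]
  · induction u with
    | nil =>
      change adjust (k b) (Z (b, [] ++ [i])) = k !b
      rw [hlast]
      refine adjust_of_ne ?_
      change (k !b) ≠ k b
      cases b
      · exact hk
      · exact hk.symm
    | cons j u ih =>
      change adjust (lab (k b) (fun u => Z (b, u)) (u ++ [i])) (Z (b, (j :: u) ++ [i])) = _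
      rw [ih, hlast]
      exact adjust_of_ne (adjust_ne _ _)

lemma measurable_lab {i : Fin n} {k : ℕ} :
    @Measurable _ _ (@MeasurableSpace.pi ℕ (fun _ => List (Fin n) → ℕ) fun _ => ⊤) _
      fun a => lab k (raw i a) := by
  let _ : MeasurableSpace (List (Fin n) → ℕ) := ⊤
  have hraw : ∀ w, Measurable fun a : ℕ → List (Fin n) → ℕ => raw i a w := by
    intro w
    have : ∀ m, Measurable fun a : ℕ → List (Fin n) → ℕ => a m w := fun m =>
      (measurable_from_top (f := fun l : List (Fin n) → ℕ => l w)).comp (measurable_pi_apply m)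
    unfold raw
    split_ifs <;> exact this _
  refine @measurable_pi_lambda _ _ _ (_) _ _ fun w => ?_
  induction w with
  | nil => exact measurable_const
  | cons j w ih =>
    exact (measurable_of_countable fun p : ℕ × ℕ => adjust p.1 p.2).comp (ih.prodMk (hraw _))

/-- There is no Borel coloring of the vertex labellings of the regular tree by its edge
labels such that adjacent vertices do not both have the color of the edge joining them. -/
theorem no_edge_free_coloring (c : (List (Fin n) → ℕ) → Fin n) (hc : Measurable c)
    (h : ∀ i y y', (∀ j w, y (j :: w) ≠ y w) → (∀ j w, y' (j :: w) ≠ y' w) →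
      (∀ u, y (u ++ [i]) = y' u) → (∀ u, y' (u ++ [i]) = y u) → c y = i → c y' ≠ i) : False := by
  have hdet := fun (i : Fin n) (k : ℕ) =>
    game_determined (W := {a : ℕ → List (Fin n) → ℕ | c (lab k (raw i a)) ≠ i}) (by
      let _ : MeasurableSpace (List (Fin n) → ℕ) := ⊤
      exact (hc.comp measurable_lab) (MeasurableSet.of_discrete (s := {i}ᶜ)))
  by_cases hI : ∃ k : ℕ, ∀ i, ∃ σ : List (List (Fin n) → ℕ) → List (Fin n) → ℕ,
      ∀ a : ℕ → List (Fin n) → ℕ, (∀ n, n % 2 = 0 → a n = σ (history a n)) →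
        c (lab k (raw i a)) ≠ i
  · obtain ⟨k, hk⟩ := hI
    obtain ⟨y, hy⟩ := exists_lab_forall (P := fun i y => c y ≠ i) hk
    exact hy _ rfl
  · push Not at hI
    choose i hi using hI
    obtain ⟨k, k', hkk, hik⟩ := Finite.exists_ne_map_eq_of_infinite i
    have hII : ∀ k, ∃ τ : List (List (Fin n) → ℕ) → List (Fin n) → ℕ,
        ∀ a : ℕ → List (Fin n) → ℕ, (∀ n, n % 2 = 1 → a n = τ (history a n)) →
          c (lab k (raw (i k) a)) = i k := by
      intro k
      rcases hdet (i k) k with ⟨σ, hσ⟩ | ⟨τ, hτ⟩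
      · obtain ⟨a, ha, ha'⟩ := hi k σ
        exact absurd ha' (hσ a ha)
      · exact ⟨τ, fun a ha => not_not.1 (hτ a ha)⟩
    obtain ⟨x, hx, hxx⟩ := exists_lab_pair (i := i k) (k := fun b => if b then k else k')
      (by simpa using hkk) (P := fun y => c y = i k) (by
        rintro (_ | _)
        · rw [hik]; exact hII k'
        · exact hII k)
    exact h (i k) _ _ (fun j w => adjust_ne _ _) (fun j w => adjust_ne _ _) (hxx true)
      (hxx false) (hx true) (hx false)

end Labelings

section FreeProduct

open Monoid.CoprodI

variable {n : ℕ}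

/-- The product of the generators listed in `l`. -/
def genProd (l : List (Fin n)) : Z2StarN n := (l.map (z2gen n)).prod

@[simp] lemma genProd_nil : genProd ([] : List (Fin n)) = 1 := rfl

@[simp] lemma genProd_cons (i : Fin n) (l : List (Fin n)) :
    genProd (i :: l) = z2gen n i * genProd l := by simp [genProd]

@[simp] lemma genProd_append (l m : List (Fin n)) :
    genProd (l ++ m) = genProd l * genProd m := by simp [genProd]

@[simp] lemma z2gen_mul_self (i : Fin n) : z2gen n i * z2gen n i = 1 := by
  rw [z2gen, ← map_mul, ← ofAdd_add, show (1 : ZMod 2) + 1 = 0 from by decide, ofAdd_zero, map_one]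

@[simp] lemma z2gen_mul_cancel_left (i : Fin n) (γ : Z2StarN n) :
    z2gen n i * (z2gen n i * γ) = γ := by rw [← mul_assoc, z2gen_mul_self, one_mul]

@[simp] lemma z2gen_inv (i : Fin n) : (z2gen n i)⁻¹ = z2gen n i :=
  inv_eq_of_mul_eq_one_right (z2gen_mul_self i)

/-- The reduced word representing an element of `(ℤ/2ℤ)^{*n}`. -/
def redWord (γ : Z2StarN n) : List (Fin n) := (Word.equiv γ).toList.map Sigma.fst

lemma eq_ofAdd_one {x : Multiplicative (ZMod 2)} (hx : x ≠ 1) : x = Multiplicative.ofAdd 1 := by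
  revert x
  decide

lemma redWord_isChain (γ : Z2StarN n) : (redWord γ).IsChain (· ≠ ·) := by
  rw [redWord, List.isChain_map]
  exact (Word.equiv γ).chain_ne

lemma genProd_redWord (γ : Z2StarN n) : genProd (redWord γ) = γ := by
  conv_rhs => rw [← Word.equiv.symm_apply_apply γ]
  change _ = Word.prod _
  rw [Word.prod, genProd, redWord, List.map_map]
  congr 1
  refine List.map_congr_left fun s hs => ?_
  rw [eq_ofAdd_one ((Word.equiv γ).ne_one s hs)]
  rfl

lemma redWord_genProd {l : List (Fin n)} (hl : l.IsChain (· ≠ ·)) : redWord (genProd l) = l := by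
  let w : Word fun _ : Fin n => Multiplicative (ZMod 2) :=
    { toList := l.map fun i => ⟨i, Multiplicative.ofAdd 1⟩
      ne_one := by
        intro s hs
        obtain ⟨i, -, rfl⟩ := List.mem_map.1 hs
        exact (by decide : (Multiplicative.ofAdd 1 : Multiplicative (ZMod 2)) ≠ 1)
      chain_ne := by
        rw [List.isChain_map]
        exact hl }
  have hw : Word.equiv (genProd l) = w := by
    rw [← Equiv.eq_symm_apply]
    change _ = Word.prod w
    rw [Word.prod, List.map_map, genProd]
    rfl
  rw [redWord, hw, List.map_map]
  exact List.map_id l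

lemma genProd_ne_one {l : List (Fin n)} (hl : l.IsChain (· ≠ ·)) (h : l ≠ []) :
    genProd l ≠ 1 := by
  intro h1
  apply h
  rw [← redWord_genProd hl, h1, ← genProd_nil, redWord_genProd .nil]

lemma redWord_inv (γ : Z2StarN n) : redWord γ⁻¹ = (redWord γ).reverse := by
  have h : ∀ l : List (Fin n), (genProd l)⁻¹ = genProd l.reverse := by
    intro l
    induction l with
    | nil => simp
    | cons i l ih => simp [ih]
  conv_lhs => rw [← genProd_redWord γ, h]
  refine redWord_genProd ?_
  rw [List.isChain_reverse]
  exact (redWord_isChain γ).imp fun _ _ h => h.symm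

lemma redWord_z2gen_mul (i : Fin n) (γ : Z2StarN n) :
    redWord (z2gen n i * γ) = i :: redWord γ ∨ redWord γ = i :: redWord (z2gen n i * γ) := by
  have hch := redWord_isChain γ
  have hp := genProd_redWord γ
  rcases hl : redWord γ with _ | ⟨j, l⟩
  · left
    rw [← hp, hl, ← genProd_cons, redWord_genProd (.singleton _)]
  · rw [hl] at hch hp
    by_cases hij : i = j
    · right
      subst hij
      rw [← hp, genProd_cons, z2gen_mul_cancel_left, redWord_genProd (l := l) hch.tail]
    · left
      rw [← hp, ← genProd_cons, redWord_genProd]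
      exact List.isChain_cons_cons.2 ⟨hij, hch⟩

lemma redWord_mul_z2gen (γ : Z2StarN n) (i : Fin n) :
    redWord (γ * z2gen n i) = redWord γ ++ [i] ∨ redWord γ = redWord (γ * z2gen n i) ++ [i] := by
  have h := redWord_z2gen_mul i γ⁻¹
  rw [show z2gen n i * γ⁻¹ = (γ * z2gen n i)⁻¹ by simp, redWord_inv, redWord_inv] at h
  rcases h with h | h
  · left
    simpa using congrArg List.reverse h
  · right
    simpa using congrArg List.reverse h

/-- The labeling of the group induced by a labeling of all words. -/
def pull (y : List (Fin n) → ℕ) (γ : Z2StarN n) : ℕ := y (redWord γ⁻¹)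

lemma measurable_pull : Measurable (pull : (List (Fin n) → ℕ) → Z2StarN n → ℕ) :=
  measurable_pi_lambda _ fun _ => measurable_pi_apply _

lemma pull_mul_z2gen_ne {y : List (Fin n) → ℕ} (hy : ∀ j w, y (j :: w) ≠ y w) (γ : Z2StarN n)
    (j : Fin n) : pull y (γ * z2gen n j) ≠ pull y γ := by
  rw [pull, pull, mul_inv_rev, z2gen_inv]
  rcases redWord_z2gen_mul j γ⁻¹ with h | h
  · rw [h]
    exact hy _ _
  · rw [h]
    exact (hy _ _).symm

lemma shift_z2gen_pull {y y' : List (Fin n) → ℕ} {i : Fin n} (h : ∀ u, y (u ++ [i]) = y' u)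
    (h' : ∀ u, y' (u ++ [i]) = y u) : shift (z2gen n i) (pull y) = pull y' := by
  ext γ
  rw [shift, pull, pull, z2gen_inv, mul_inv_rev, z2gen_inv]
  rcases redWord_mul_z2gen γ⁻¹ i with e | e
  · rw [e, h]
  · rw [e, h']

end FreeProduct

section Selection

lemma exists_measurable_select {Ω ι : Type*} [MeasurableSpace Ω] [Countable ι] [Nonempty ι]
    [MeasurableSpace ι] (P : Ω → ι → Prop) (hP : ∀ i, Measurable fun y => P y i) :
    ∃ f : Ω → ι, Measurable f ∧ ∀ y, (∃ i, P y i) → P y (f y) := by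
  classical
  obtain ⟨e, he⟩ := exists_surjective_nat ι
  let p : Ω → ℕ → Prop := fun y k => P y (e k) ∨ ∀ i, ¬ P y i
  have hp : ∀ y, ∃ k, p y k := by
    intro y
    by_cases h : ∃ i, P y i
    · obtain ⟨i, hi⟩ := h
      obtain ⟨k, rfl⟩ := he i
      exact ⟨k, .inl hi⟩
    · exact ⟨0, .inr (not_exists.1 h)⟩
  have hm : ∀ k, MeasurableSet {y | p y k} := fun k =>
    ((hP _).or (.forall fun i => (hP i).not)).setOf
  refine ⟨fun y => e (Nat.find (hp y)),
    (measurable_of_countable e).comp (measurable_find hp hm), fun y ⟨i, hi⟩ => ?_⟩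
  exact (Nat.find_spec (hp y)).resolve_right fun h => h i hi

end Selection

section Shift

variable {Γ : Type*} [Group Γ]

@[simp] lemma shift_one_apply {X : Type*} (y : Γ → X) : shift 1 y = y := by
  ext; simp [shift]

@[simp] lemma shift_shift {X : Type*} (γ δ : Γ) (y : Γ → X) :
    shift γ (shift δ y) = shift (γ * δ) y := by
  ext; simp [shift, mul_assoc]

lemma shift_injective {X : Type*} (γ : Γ) : Function.Injective (shift γ : (Γ → X) → Γ → X) := by
  intro x y h
  simpa using congrArg (shift γ⁻¹) h

lemma measurable_shift {X : Type*} [MeasurableSpace X] (γ : Γ) :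
    Measurable (shift γ : (Γ → X) → Γ → X) :=
  measurable_pi_lambda _ fun _ => measurable_pi_apply _

lemma exists_measurable_separating [Countable Γ] (γ : Γ) :
    ∃ q : (Γ → ℕ) → ℕ, Measurable q ∧ ∀ y, shift γ y ≠ y → q y ≠ q (shift γ y) := by
  let _ : MeasurableSpace (Γ × ℕ) := ⊤
  have happ : ∀ β, Measurable fun y : Γ → ℕ => y β := measurable_pi_apply
  obtain ⟨f, hf, h⟩ := exists_measurable_select (Ω := Γ → ℕ) (ι := Γ × ℕ)
    (fun y i => y i.1 = i.2 ∧ y (γ⁻¹ * i.1) ≠ i.2) fun i =>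
      ((happ i.1).eq_const i.2).and ((happ (γ⁻¹ * i.1)).eq_const i.2).not
  obtain ⟨e, he⟩ := exists_injective_nat (Γ × ℕ)
  have key : ∀ y, shift γ y ≠ y →
      y (f y).1 = (f y).2 ∧ y (γ⁻¹ * (f y).1) ≠ (f y).2 := by
    intro y hy
    refine h y ?_
    obtain ⟨β, hβ⟩ := Function.ne_iff.1 hy
    exact ⟨(β, y β), rfl, hβ⟩
  refine ⟨e ∘ f, (measurable_of_countable e).comp hf, fun y hy hq => ?_⟩
  have hq := he hq
  have h1 := key (shift γ y) (fun h => hy (shift_injective γ h))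
  rw [← hq] at h1
  exact (key y hy).2 h1.1

end Shift

section Orientation

variable {n : ℕ}

instance : Countable (Z2StarN n) :=
  (Function.LeftInverse.injective (g := genProd) genProd_redWord).countable

/-- The group element obtained by successively multiplying by the first `k` letters of `w`
on the left. -/
def pathElt (w : ℕ → Fin n) : ℕ → Z2StarN n
  | 0 => 1
  | k + 1 => z2gen n (w k) * pathElt w k

lemma pathElt_add (w : ℕ → Fin n) (k l : ℕ) :
    pathElt w (k + l) = pathElt (fun j => w (l + j)) k * pathElt w l := by
  induction k with
  | zero => simp [pathElt]
  | succ k ih => rw [Nat.succ_add, pathElt, ih, pathElt, mul_assoc, add_comm l k]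

lemma pathElt_congr {w w' : ℕ → Fin n} {k : ℕ} (h : ∀ j < k, w j = w' j) :
    pathElt w k = pathElt w' k := by
  induction k with
  | zero => rfl
  | succ k ih =>
    rw [pathElt, pathElt, h k k.lt_succ_self, ih fun j hj => h j (hj.trans k.lt_succ_self)]

lemma exists_pathElt_eq [NeZero n] {γ : Z2StarN n} (hγ : γ ≠ 1) :
    ∃ (w : ℕ → Fin n) (l : ℕ), 0 < l ∧ (∀ k, k + 1 < l → w k ≠ w (k + 1)) ∧ pathElt w l = γ := by
  have key : ∀ l : List (Fin n), pathElt (fun k => l.reverse.getD k 0) l.length = genProd l := by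
    intro l
    induction l with
    | nil => rfl
    | cons i l ih =>
      rw [List.length_cons, pathElt, genProd_cons, ← ih]
      congr 1
      · simp [List.getD_eq_getElem?_getD]
      · refine pathElt_congr fun j hj => ?_
        simp [List.getD_eq_getElem?_getD, List.getElem?_append, hj]
  refine ⟨_, _, ?_, ?_, (key (redWord γ)).trans (genProd_redWord γ)⟩
  · rw [List.length_pos_iff]
    intro h
    apply hγ
    rw [← genProd_redWord γ, h, genProd_nil]
  · intro k hk
    have h1 : (redWord γ).reverse.IsChain (· ≠ ·) := by
      rw [← redWord_inv]
      exact redWord_isChain _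
    have hk' : k + 1 < (redWord γ).reverse.length := by simpa using hk
    have := List.isChain_iff_getElem.1 h1 k hk'
    rwa [List.getD_eq_getElem _ _ (Nat.lt_of_succ_lt hk'), List.getD_eq_getElem _ _ hk']

/-- The length, letters and labels of a closed path. -/
abbrev CycleType (n : ℕ) : Type :=
  Σ l : ℕ, (Fin (l + 1) → Fin n) × (Fin (l + 1) → Fin (l + 1) → ℕ)

namespace CycleType

/-- The periodic sequence of letters of a closed path. -/
def letter (t : CycleType n) (k : ℕ) : Fin n := t.2.1 (Fin.ofNat _ k)

variable (q : Z2StarN n → (Z2StarN n → ℕ) → ℕ) (t : CycleType n)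

/-- The point `y` is the base point of a closed path of type `t`. -/
def Base (y : Z2StarN n → ℕ) : Prop :=
  shift (pathElt t.letter (t.1 + 1)) y = y ∧ (∀ k, t.letter k ≠ t.letter (k + 1)) ∧
    (∀ k l, shift (pathElt t.letter k) y = shift (pathElt t.letter l) y →
      t.letter k = t.letter l) ∧
    ∀ k l, q ((pathElt t.letter (l : Fin _))⁻¹ * pathElt t.letter (k : Fin _)) y = t.2.2 k l

/-- The point `y` lies on a closed path of type `t` with the next edge labeled by `i`. -/
def Next (y : Z2StarN n → ℕ) (i : Fin n) : Prop :=
  ∃ k, Base q t (shift (pathElt t.letter k)⁻¹ y) ∧ t.letter k = i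

/-- The point `y` has distance at most `r` from a closed path of type `t`. -/
def Within : ℕ → (Z2StarN n → ℕ) → Prop
  | 0, y => ∃ k, Base q t (shift (pathElt t.letter k)⁻¹ y)
  | r + 1, y => Within r y ∨ ∃ i, Within r (shift (z2gen n i) y)

/-- The edge from `y` labeled by `i` follows a closed path of type `t`, or approaches one. -/
def Directed (y : Z2StarN n → ℕ) (i : Fin n) : Prop :=
  Next q t y i ∨ ∃ r, ¬ Within q t r y ∧ Within q t r (shift (z2gen n i) y)

variable {q t} {y y' : Z2StarN n → ℕ}

lemma letter_add (k : ℕ) : t.letter (k + (t.1 + 1)) = t.letter k := by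
  simp [letter, Fin.ofNat]

lemma shift_pathElt_mod (h : shift (pathElt t.letter (t.1 + 1)) y = y) (k : ℕ) :
    shift (pathElt t.letter (k % (t.1 + 1))) y = shift (pathElt t.letter k) y := by
  induction k using Nat.strong_induction_on with
  | _ k ih =>
    rcases lt_or_ge k (t.1 + 1) with hk | hk
    · rw [Nat.mod_eq_of_lt hk]
    · obtain ⟨j, rfl⟩ := Nat.exists_eq_add_of_le' hk
      rw [Nat.add_mod_right, ih j (by omega), pathElt_add, ← shift_shift, h]
      congr 2
      funext m
      rw [add_comm, letter_add]

lemma Base.letter_eq (hq : ∀ γ y, shift γ y ≠ y → q γ y ≠ q γ (shift γ y)) (h : Base q t y)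
    (h' : Base q t y') {k l : ℕ}
    (e : shift (pathElt t.letter k) y = shift (pathElt t.letter l) y') :
    t.letter k = t.letter l := by
  let k' : Fin (t.1 + 1) := ⟨k % (t.1 + 1), Nat.mod_lt _ (Nat.succ_pos _)⟩
  let l' : Fin (t.1 + 1) := ⟨l % (t.1 + 1), Nat.mod_lt _ (Nat.succ_pos _)⟩
  have e' : shift (pathElt t.letter k') y = shift (pathElt t.letter l') y' := by
    rw [shift_pathElt_mod h.1, shift_pathElt_mod h'.1, e]
  have hy : shift ((pathElt t.letter l')⁻¹ * pathElt t.letter k') y = y' := by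
    rw [← shift_shift, e', shift_shift, inv_mul_cancel, shift_one_apply]
  have hyy : y = y' := by
    by_contra hne
    refine hq _ y (fun h0 => hne ?_) (((h.2.2.2 k' l').trans (h'.2.2.2 k' l').symm).trans ?_)
    · rw [← h0, hy]
    · rw [hy]
  subst hyy
  exact h.2.2.1 _ _ e

lemma Next.within (h : Next q t y i) : Within q t 0 y := by
  obtain ⟨k, hk, -⟩ := h
  exact ⟨k, hk⟩

lemma Next.within_shift (h : Next q t y i) : Within q t 0 (shift (z2gen n i) y) := by
  obtain ⟨k, hk, rfl⟩ := h
  refine ⟨k + 1, ?_⟩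
  rw [pathElt, shift_shift, mul_inv_rev, inv_mul_cancel_right]
  exact hk

lemma within_mono {r s : ℕ} (h : r ≤ s) (hr : Within q t r y) : Within q t s y := by
  induction h with
  | refl => exact hr
  | step _ ih => exact .inl ih

lemma Next.not_next (hq : ∀ γ y, shift γ y ≠ y → q γ y ≠ q γ (shift γ y)) (h : Next q t y i) :
    ¬ Next q t (shift (z2gen n i) y) i := by
  obtain ⟨k, hk, rfl⟩ := h
  rintro ⟨l, hl, e⟩
  refine hk.2.1 k ?_
  rw [← e]
  symm
  refine Base.letter_eq hq hk hl ?_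
  simp [pathElt]

lemma Directed.not_directed (hq : ∀ γ y, shift γ y ≠ y → q γ y ≠ q γ (shift γ y))
    (h : Directed q t y i) : ¬ Directed q t (shift (z2gen n i) y) i := by
  rintro (h' | ⟨s, hs, hs'⟩)
  · rcases h with h | ⟨r, hr, -⟩
    · exact h.not_next hq h'
    · have := h'.within_shift
      rw [shift_shift, z2gen_mul_self, shift_one_apply] at this
      exact hr (within_mono r.zero_le this)
  · rw [shift_shift, z2gen_mul_self, shift_one_apply] at hs'
    rcases h with h | ⟨r, hr, hr'⟩
    · exact hs (within_mono s.zero_le h.within_shift)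
    · rcases le_total r s with hrs | hrs
      · exact hs (within_mono hrs hr')
      · exact hr (within_mono hrs hs')

lemma exists_directed {γ : Z2StarN n} (h : Base q t (shift γ y)) : ∃ i, Directed q t y i := by
  classical
  have key : ∀ (l : List (Fin n)) z, Base q t (shift (genProd l) z) → ∃ r, Within q t r z := by
    intro l
    induction l using List.reverseRecOn with
    | nil =>
      intro z hz
      exact ⟨0, 0, by simpa [pathElt] using hz⟩
    | append_singleton l i ih =>
      intro z hz
      rw [genProd_append, ← shift_shift] at hz
      obtain ⟨r, hr⟩ := ih _ hz
      exact ⟨r + 1, .inr ⟨i, by simpa using hr⟩⟩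
  rw [← genProd_redWord γ] at h
  have hr := key _ _ h
  rcases hk : Nat.find hr with _ | r
  · have := Nat.find_spec hr
    rw [hk] at this
    obtain ⟨k, hk⟩ := this
    exact ⟨_, .inl ⟨k, hk, rfl⟩⟩
  · have hnot : ¬ Within q t r y := Nat.find_min hr (by omega)
    have := Nat.find_spec hr
    rw [hk] at this
    obtain ⟨i, hi⟩ := this.resolve_left hnot
    exact ⟨i, .inr ⟨r, hnot, hi⟩⟩

lemma measurable_base (hq : ∀ γ, Measurable (q γ)) : Measurable fun y => Base q t y := by
  exact ((measurable_shift _).eq measurable_id).and (measurable_const.and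
    ((Measurable.forall fun k => .forall fun l =>
      ((measurable_shift _).eq (measurable_shift _)).imp measurable_const).and
    (.forall fun k => .forall fun l => (hq _).eq_const _)))

lemma measurable_next (hq : ∀ γ, Measurable (q γ)) (i : Fin n) :
    Measurable fun y => Next q t y i :=
  .exists fun _ => ((measurable_base hq).comp (measurable_shift _)).and measurable_const

lemma measurable_within (hq : ∀ γ, Measurable (q γ)) (r : ℕ) :
    Measurable fun y => Within q t r y := by
  induction r with
  | zero => exact .exists fun _ => (measurable_base hq).comp (measurable_shift _)
  | succ r ih => exact ih.or (.exists fun _ => ih.comp (measurable_shift _))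

lemma measurable_directed (hq : ∀ γ, Measurable (q γ)) (i : Fin n) :
    Measurable fun y => Directed q t y i :=
  (measurable_next hq i).or (.exists fun r => (measurable_within hq r).not.and
    ((measurable_within hq r).comp (measurable_shift _)))

lemma exists_base [NeZero n] (hy : ∀ γ j, shift (z2gen n j * γ) y ≠ shift γ y)
    (hfree : y ∉ freePart (Z2StarN n) ℕ) : ∃ t γ, Base q t (shift γ y) := by
  classical
  have hex : ∃ l, 0 < l ∧ ∃ (w : ℕ → Fin n) (γ : Z2StarN n),
      (∀ k, k + 1 < l → w k ≠ w (k + 1)) ∧ shift (pathElt w l) (shift γ y) = shift γ y := by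
    simp only [freePart, Set.mem_ofPred_eq, not_forall, not_not] at hfree
    obtain ⟨γ, h1, hγ⟩ := hfree
    obtain ⟨w, l, hl, hw, rfl⟩ := exists_pathElt_eq h1
    exact ⟨l, hl, w, 1, hw, by simpa using hγ⟩
  obtain ⟨hl, w, γ, hw, hfix⟩ := Nat.find_spec hex
  have hmin : ∀ m < Nat.find hex, _ := fun m hm => Nat.find_min hex hm
  generalize Nat.find hex = L at hl hw hfix hmin
  have hsimple : ∀ k l, k < l → l ≤ L → l - k < L →
      shift (pathElt w k) (shift γ y) ≠ shift (pathElt w l) (shift γ y) := by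
    intro k l hkl hlL hlt e
    refine hmin (l - k) hlt ⟨by omega, fun j => w (k + j), pathElt w k * γ, fun j hj => ?_, ?_⟩
    · exact hw (k + j) (by omega)
    · rw [← shift_shift (pathElt w k), shift_shift (pathElt _ _), ← pathElt_add,
        Nat.sub_add_cancel hkl.le, e]
  have hcyc : w (L - 1) ≠ w 0 := by
    intro e
    obtain rfl | rfl | hL : L = 1 ∨ L = 2 ∨ 3 ≤ L := by omega
    · exact hy γ (w 0) (by simpa [pathElt] using hfix)
    · exact hw 0 (by omega) e.symm
    · refine hsimple 1 (L - 1) (by omega) (by omega) (by omega) ?_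
      obtain ⟨m, rfl⟩ : ∃ m, L = m + 1 := ⟨L - 1, by omega⟩
      rw [Nat.add_sub_cancel] at e ⊢
      rw [pathElt, e] at hfix
      have := congrArg (shift (z2gen n (w 0))) hfix
      simpa [pathElt, mul_assoc] using this.symm
  obtain ⟨L, rfl⟩ : ∃ m, L = m + 1 := ⟨L - 1, by omega⟩
  let v : Fin (L + 1) → Fin n := fun k => w k
  let t₀ : CycleType n := ⟨L, v, 0⟩
  have hpath : ∀ k ≤ L + 1, pathElt t₀.letter k = pathElt w k := fun k hk =>
    pathElt_congr fun j hj => by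
      simp only [letter, t₀, v, Fin.ofNat]
      rw [Nat.mod_eq_of_lt (by omega)]
  refine ⟨⟨L, v, fun k l => q ((pathElt t₀.letter l)⁻¹ * pathElt t₀.letter k) (shift γ y)⟩, γ,
    ?_, ?_, ?_, fun k l => rfl⟩
  · change shift (pathElt t₀.letter (L + 1)) _ = _
    rw [hpath _ le_rfl, hfix]
  · intro k
    change w (k % (L + 1)) ≠ w ((k + 1) % (L + 1))
    have hk : k % (L + 1) < L + 1 := Nat.mod_lt k L.succ_pos
    rw [← Nat.mod_add_mod]
    generalize k % (L + 1) = m at hk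
    rcases Nat.lt_succ_iff_lt_or_eq.1 hk with h | rfl
    · rw [Nat.mod_eq_of_lt (by omega)]
      exact hw _ (by omega)
    · rw [Nat.mod_self]
      exact hcyc
  · intro k l e
    change shift (pathElt t₀.letter k) _ = shift (pathElt t₀.letter l) _ at e
    change w (k % (L + 1)) = w (l % (L + 1))
    have h0 : shift (pathElt t₀.letter (t₀.1 + 1)) (shift γ y) = shift γ y := by
      rw [hpath _ le_rfl, hfix]
    have hk : k % (L + 1) < L + 1 := Nat.mod_lt k L.succ_pos
    have hl : l % (L + 1) < L + 1 := Nat.mod_lt l L.succ_pos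
    rw [← shift_pathElt_mod h0 k, ← shift_pathElt_mod h0 l, hpath _ hk.le, hpath _ hl.le] at e
    change shift (pathElt w (k % (L + 1))) _ = shift (pathElt w (l % (L + 1))) _ at e
    rcases lt_trichotomy (k % (L + 1)) (l % (L + 1)) with h | h | h
    · exact absurd e (hsimple _ _ h (by omega) (by omega))
    · rw [h]
    · exact absurd e.symm (hsimple _ _ h (by omega) (by omega))

end CycleType

/-- A Borel choice of outgoing edges on the points with nontrivial stabilizers. -/
lemma exists_sinkless_orientation [NeZero n] : ∃ P : (Z2StarN n → ℕ) → Fin n → Prop,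
    (∀ i, Measurable fun y => P y i) ∧ (∀ y i, P y i → ¬ P (shift (z2gen n i) y) i) ∧
    ∀ y, (∀ γ j, shift (z2gen n j * γ) y ≠ shift γ y) → y ∉ freePart (Z2StarN n) ℕ →
      ∃ i, P y i := by
  classical
  choose q hqm hq using fun γ : Z2StarN n => exists_measurable_separating γ
  obtain ⟨T, hT⟩ := exists_surjective_nat (CycleType n)
  let E : ℕ → (Z2StarN n → ℕ) → Prop := fun m y => ∃ γ, CycleType.Base q (T m) (shift γ y)
  have hE : ∀ m y γ, E m (shift γ y) ↔ E m y := by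
    intro m y γ
    constructor
    · rintro ⟨δ, h⟩
      exact ⟨δ * γ, by rwa [← shift_shift]⟩
    · rintro ⟨δ, h⟩
      exact ⟨δ * γ⁻¹, by simpa using h⟩
  have hEm : ∀ m, Measurable fun y => E m y := fun m =>
    .exists fun γ => (CycleType.measurable_base hqm).comp (measurable_shift _)
  refine ⟨fun y i => ∃ m, (E m y ∧ ∀ m' < m, ¬ E m' y) ∧ CycleType.Directed q (T m) y i,
    fun i => .exists fun m => ((hEm m).and (.forall fun m' => .forall fun _ => (hEm m').not)).and
      (CycleType.measurable_directed hqm i), ?_, fun y hy hfree => ?_⟩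
  · rintro y i ⟨m, ⟨hm, hmin⟩, h⟩ ⟨m', ⟨hm', hmin'⟩, h'⟩
    simp only [hE] at hm' hmin'
    obtain rfl : m = m' := by
      rcases lt_trichotomy m m' with hlt | heq | hlt
      · exact absurd hm (hmin' m hlt)
      · exact heq
      · exact absurd hm' (hmin m' hlt)
    exact h.not_directed hq h'
  · have hex : ∃ m, E m y := by
      obtain ⟨t, γ, h⟩ := CycleType.exists_base (q := q) hy hfree
      obtain ⟨m, rfl⟩ := hT t
      exact ⟨m, γ, h⟩
    obtain ⟨γ, h⟩ := Nat.find_spec hex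
    obtain ⟨i, hi⟩ := CycleType.exists_directed h
    exact ⟨i, Nat.find hex, ⟨⟨γ, h⟩, fun m' hm' => Nat.find_min hex hm'⟩, hi⟩

end Orientation

section FreePart

variable {n : ℕ}

lemma shift_mem_freePart {Γ X : Type*} [Group Γ] {y : Γ → X} (hy : y ∈ freePart Γ X) (δ : Γ) :
    shift δ y ∈ freePart Γ X := by
  intro γ hγ h
  refine hy (δ⁻¹ * γ * δ) (fun h1 => hγ ?_) ?_
  · rwa [mul_assoc, inv_mul_eq_one, eq_comm, mul_eq_right] at h1
  · simpa [mul_assoc] using congrArg (shift δ⁻¹) h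

lemma shift_mem_freePart_iff {Γ X : Type*} [Group Γ] {y : Γ → X} {δ : Γ} :
    shift δ y ∈ freePart Γ X ↔ y ∈ freePart Γ X :=
  ⟨fun h => by simpa using shift_mem_freePart h δ⁻¹, fun h => shift_mem_freePart h δ⟩

lemma measurable_mem_freePart {Γ : Type*} [Group Γ] [Countable Γ] :
    Measurable fun y => y ∈ freePart Γ ℕ :=
  .forall fun γ => measurable_const.imp ((measurable_shift γ).eq measurable_id).not

lemma no_measurable_coloring [NeZero n] (c : (Z2StarN n → ℕ) → Fin n) (hc : Measurable c)
    (h : ∀ y ∈ freePart (Z2StarN n) ℕ, ∀ i, c y ≠ c (shift (z2gen n i) y)) : False := by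
  obtain ⟨P, hPm, hP, hPe⟩ := exists_sinkless_orientation (n := n)
  obtain ⟨d, hdm, hd⟩ := exists_measurable_select
    (fun y i => (y ∈ freePart (Z2StarN n) ℕ ∧ c y = i) ∨ (y ∉ freePart (Z2StarN n) ℕ ∧ P y i))
    fun i => (measurable_mem_freePart.and (hc.eq_const i)).or
      (measurable_mem_freePart.not.and (hPm i))
  have key : ∀ y : List (Fin n) → ℕ, (∀ j w, y (j :: w) ≠ y w) →
      (pull y ∈ freePart (Z2StarN n) ℕ ∧ c (pull y) = d (pull y)) ∨
        (pull y ∉ freePart (Z2StarN n) ℕ ∧ P (pull y) (d (pull y))) := by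
    intro y hy
    refine hd _ ?_
    by_cases hf : pull y ∈ freePart (Z2StarN n) ℕ
    · exact ⟨_, .inl ⟨hf, rfl⟩⟩
    · have hne : ∀ γ j, shift (z2gen n j * γ) (pull y) ≠ shift γ (pull y) := by
        intro γ j e
        refine pull_mul_z2gen_ne hy γ⁻¹ j ?_
        simpa [shift] using congrFun e 1
      obtain ⟨i, hi⟩ := hPe (pull y) hne hf
      exact ⟨i, .inr ⟨hf, hi⟩⟩
  refine no_edge_free_coloring (d ∘ pull) (hdm.comp measurable_pull) ?_
  intro i y y' hy hy' hyy' hy'y e e'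
  have hs := shift_z2gen_pull hyy' hy'y
  have k := key y hy
  have k' := key y' hy'
  simp only [Function.comp_apply] at e e'
  rw [e'] at k'
  rw [e] at k
  rw [← hs, shift_mem_freePart_iff] at k'
  rcases k with ⟨hf, k⟩ | ⟨hf, k⟩ <;> rcases k' with ⟨hf', k'⟩ | ⟨hf', k'⟩
  · exact h _ hf i (k.trans k'.symm)
  · exact hf' hf
  · exact hf hf'
  · exact hP _ _ k k'

lemma exists_greedy_coloring {Ω : Type*} [MeasurableSpace Ω] (f : Fin n → Ω → Ω)
    (hf : ∀ i, Measurable (f i)) (hff : ∀ i x, f i (f i x) = x) (q : Ω → ℕ) (hqm : Measurable q)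
    (hq : ∀ i x, q x ≠ q (f i x)) :
    ∃ d : Ω → Fin (n + 1), Measurable d ∧ ∀ i x, d x ≠ d (f i x) := by
  classical
  have step : ∀ (m : ℕ) (D : {D : Ω → Fin (n + 1) // Measurable D}),
      ∃ D' : {D : Ω → Fin (n + 1) // Measurable D}, (∀ x, q x ≠ m → D'.1 x = D.1 x) ∧
        ∀ x, q x = m → ∀ i, D'.1 x ≠ D.1 (f i x) := by
    rintro m ⟨D, hD⟩
    obtain ⟨e, hem, he⟩ := exists_measurable_select (fun x k => ∀ i, ¬ D (f i x) = k)
      fun k => .forall fun i => ((hD.comp (hf i)).eq_const k).not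
    refine ⟨⟨fun x => if q x = m then e x else D x,
      .ite (hqm (measurableSet_singleton m)) hem hD⟩, fun x hx => if_neg hx, fun x hx i => ?_⟩
    simp only [if_pos hx]
    refine Ne.symm (he x ?_ i)
    by_contra! hcon
    have hsurj : Function.Surjective fun i => D (f i x) := hcon
    simpa using Fintype.card_le_of_surjective _ hsurj
  choose S hS hS' using step
  let D : ℕ → {D : Ω → Fin (n + 1) // Measurable D} :=
    fun m => Nat.rec ⟨fun _ => 0, measurable_const⟩ S m
  have hstable : ∀ x m, q x < m → (D m).1 x = (D (q x + 1)).1 x := by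
    intro x m hm
    induction hm with
    | refl => rfl
    | @step m hm ih =>
      rw [← ih]
      exact hS m (D m) x (Nat.ne_of_lt hm)
  have hlt : ∀ i x, q (f i x) < q x → (D (q x + 1)).1 x ≠ (D (q (f i x) + 1)).1 (f i x) := by
    intro i x h
    rw [← hstable (f i x) _ h]
    exact hS' (q x) (D (q x)) x rfl i
  refine ⟨fun x => (D (q x + 1)).1 x, ?_, fun i x => ?_⟩
  · have : Measurable fun p : Ω × ℕ => (D (p.2 + 1)).1 p.1 :=
      measurable_from_prod_countable_left fun m => (D (m + 1)).2
    exact this.comp (measurable_id.prodMk hqm)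
  · rcases lt_or_gt_of_ne (hq i x) with h | h
    · have := hlt i (f i x)
      rw [hff] at this
      exact (this h).symm
    · exact hlt i x h

lemma z2gen_ne_one (i : Fin n) : z2gen n i ≠ 1 := by
  simpa using genProd_ne_one (List.isChain_singleton i) (by simp)

lemma z2gen_injective : Function.Injective (z2gen n) := by
  intro i j h
  have hi := redWord_genProd (List.isChain_singleton i)
  have hj := redWord_genProd (List.isChain_singleton j)
  rw [genProd_cons] at hi hj
  rw [h, hj] at hi
  simpa using hi.symm

lemma pathElt_ne_one {w : ℕ → Fin n} {l : ℕ} (hl : 0 < l)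
    (hw : ∀ k, k + 1 < l → w k ≠ w (k + 1)) : pathElt w l ≠ 1 := by
  have key : ∀ l, pathElt w l = genProd ((List.range l).map w).reverse := by
    intro l
    induction l with
    | zero => rfl
    | succ l ih => simp [pathElt, ih, List.range_succ]
  rw [key]
  refine genProd_ne_one ?_ (by simpa using hl.ne')
  rw [List.isChain_reverse, List.isChain_map, List.isChain_iff_getElem]
  intro k hk
  simp only [List.getElem_range]
  exact (hw k (by simpa using hk)).symm

/-- The action of a generator on the free part. -/
def freeFlip (i : Fin n) (x : freePart (Z2StarN n) ℕ) : freePart (Z2StarN n) ℕ :=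
  ⟨shift (z2gen n i) x, shift_mem_freePart x.2 _⟩

lemma measurable_freeFlip (i : Fin n) : Measurable (freeFlip i) :=
  ((measurable_shift _).comp measurable_subtype_coe).subtype_mk

lemma freeFlip_freeFlip (i : Fin n) (x : freePart (Z2StarN n) ℕ) :
    freeFlip i (freeFlip i x) = x :=
  Subtype.ext (by simp [freeFlip])

lemma freeFlip_injective (x : freePart (Z2StarN n) ℕ) :
    Function.Injective fun i => freeFlip i x := by
  intro i j h
  have h := congrArg Subtype.val h
  change shift _ _ = shift _ _ at h
  by_contra hij
  refine x.2 ((z2gen n j)⁻¹ * z2gen n i) (fun h1 => hij (z2gen_injective ?_)) ?_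
  · exact (inv_mul_eq_one.1 h1).symm
  · rw [← shift_shift, h]
    simp

lemma cayleyAdj_iff {x y : freePart (Z2StarN n) ℕ} :
    cayleyAdj (Set.range (z2gen n)) ℕ x y ↔ ∃ i, freeFlip i x = y := by
  constructor
  · rintro ⟨_, ⟨i, rfl⟩, h | h⟩
    · exact ⟨i, Subtype.ext h⟩
    · exact ⟨i, Subtype.ext (by simp [freeFlip, ← h])⟩
  · rintro ⟨i, rfl⟩
    exact ⟨_, ⟨i, rfl⟩, .inl rfl⟩

lemma measurableSet_freeFlip_adj : MeasurableSet
    {p : freePart (Z2StarN n) ℕ × freePart (Z2StarN n) ℕ | ∃ i, freeFlip i p.1 = p.2} := by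
  simp only [Subtype.ext_iff]
  exact (Measurable.exists fun i => Measurable.eq
    (measurable_subtype_coe.comp ((measurable_freeFlip i).comp measurable_fst))
    (measurable_subtype_coe.comp measurable_snd)).setOf

lemma exists_freeFlip_coloring : ∃ d : freePart (Z2StarN n) ℕ → Fin (n + 1),
    Measurable d ∧ ∀ i x, d x ≠ d (freeFlip i x) := by
  choose q hqm hq using fun i : Fin n => exists_measurable_separating (z2gen n i)
  obtain ⟨e, he⟩ := exists_injective_nat (Fin n → ℕ)
  refine exists_greedy_coloring freeFlip measurable_freeFlip freeFlip_freeFlip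
    (fun x => e fun i => q i x) ?_ fun i x h => ?_
  · exact (measurable_of_countable e).comp
      (measurable_pi_lambda _ fun i => (hqm i).comp measurable_subtype_coe)
  · exact hq i x (x.2 _ (z2gen_ne_one i)) (congrFun (he h) i)

lemma no_measurable_freeFlip_coloring [NeZero n] (c : freePart (Z2StarN n) ℕ → Fin n)
    (hc : Measurable c) (h : ∀ i x, c x ≠ c (freeFlip i x)) : False := by
  obtain ⟨c', hc', rfl⟩ := (MeasurableEmbedding.subtype_coe
    (measurable_mem_freePart (Γ := Z2StarN n)).setOf).exists_measurable_extend hc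
      fun _ => inferInstance
  exact no_measurable_coloring c' hc' fun y hy i => h i ⟨y, hy⟩

lemma isAcyclic_of_adj_iff {H : SimpleGraph (freePart (Z2StarN n) ℕ)}
    (hH : ∀ x y, H.Adj x y ↔ ∃ i, freeFlip i x = y) : H.IsAcyclic := by
  intro v p hp
  have h3 := hp.three_le_length
  have hadj : ∀ k, ∃ i, k < p.length → freeFlip i (p.getVert k) = p.getVert (k + 1) := by
    intro k
    by_cases hk : k < p.length
    · obtain ⟨i, hi⟩ := (hH _ _).1 (p.adj_getVert_succ hk)
      exact ⟨i, fun _ => hi⟩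
    · obtain ⟨i, -⟩ := (hH _ _).1 (p.adj_getVert_succ (i := 0) (by omega))
      exact ⟨i, fun h => absurd h hk⟩
  choose w hw using hadj
  have hpath : ∀ k ≤ p.length, shift (pathElt w k) v.1 = (p.getVert k).1 := by
    intro k
    induction k with
    | zero => simp [pathElt]
    | succ k ih =>
      intro hk
      rw [pathElt, ← shift_shift, ih (by omega), ← hw k (by omega)]
      rfl
  refine v.2 (pathElt w p.length) (pathElt_ne_one (by omega) fun k hk e => ?_) ?_
  · have h2 : p.getVert k = p.getVert (k + 1 + 1) := by
      rw [← hw (k + 1) hk, ← hw k (by omega), ← e, freeFlip_freeFlip]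
    rcases k with _ | k
    · have := hp.getVert_injOn' (x₁ := 0) (x₂ := 2) (by simp) (by simp; omega) h2
      omega
    · have := hp.getVert_injOn (x₁ := k + 1) (x₂ := k + 1 + 1 + 1) (by simp; omega)
        (by simp; omega) h2
      omega
  · rw [hpath _ le_rfl, p.getVert_length]

lemma borelChromaticNumber_eq [NeZero n]
    {G : freePart (Z2StarN n) ℕ → freePart (Z2StarN n) ℕ → Prop}
    (hG : ∀ x y, G x y ↔ ∃ i, freeFlip i x = y) :
    borelChromaticNumber G = ((n + 1 : ℕ) : Cardinal) := by
  obtain ⟨d, hdm, hd⟩ := exists_freeFlip_coloring (n := n)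
  have hmem : ((n + 1 : ℕ) : Cardinal) ∈ {κ : Cardinal | ∃ (Y : Type) (mY : MeasurableSpace Y),
      @StandardBorelSpace Y mY ∧ Cardinal.mk Y = κ ∧
      ∃ c : freePart (Z2StarN n) ℕ → Y, Measurable c ∧ ∀ x y, G x y → c x ≠ c y} := by
    refine ⟨Fin (n + 1), inferInstance, inferInstance, by simp, d, hdm, fun x y hxy => ?_⟩
    obtain ⟨i, rfl⟩ := (hG _ _).1 hxy
    exact hd i x
  refine le_antisymm (csInf_le' hmem) (le_csInf ⟨_, hmem⟩ ?_)
  rintro κ ⟨Y, mY, hY, rfl, c, hc, h⟩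
  by_contra! hlt
  have hle : Cardinal.mk Y ≤ Cardinal.mk (Fin n) := by
    rw [Cardinal.mk_fin]
    rwa [Nat.cast_add_one, ← Cardinal.succ_natCast, Order.lt_succ_iff] at hlt
  obtain ⟨e⟩ := (Cardinal.le_def _ _).1 hle
  have : Countable Y := e.injective.countable
  exact no_measurable_freeFlip_coloring (e ∘ c) ((measurable_of_countable e).comp hc)
    fun i x he => h _ _ ((hG _ _).2 ⟨i, rfl⟩) (e.injective he)

lemma encard_neighborSet {H : SimpleGraph (freePart (Z2StarN n) ℕ)}
    (hH : ∀ x y, H.Adj x y ↔ ∃ i, freeFlip i x = y) (x : freePart (Z2StarN n) ℕ) :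
    (H.neighborSet x).encard = n := by
  have : H.neighborSet x = Set.range fun i => freeFlip i x := Set.ext fun y => hH x y
  rw [this, ← Set.image_univ, (freeFlip_injective x).encard_image]
  simp

end FreePart

/-- For every `n ≥ 1`, the graph `G((ℤ/2ℤ)^{*n}, ℕ)` (each copy of `ℤ/2ℤ` being marked by
its nonidentity element) is an `n`-regular acyclic Borel graph with Borel chromatic
number `n + 1`. -/
theorem stmt_3 (n : ℕ) (hn : 1 ≤ n)
    (H : SimpleGraph ↥(freePart (Z2StarN n) ℕ))
    (hH : ∀ x y, H.Adj x y ↔ cayleyAdj (Set.range (z2gen n)) ℕ x y) :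
    MeasurableSet {p : ↥(freePart (Z2StarN n) ℕ) × ↥(freePart (Z2StarN n) ℕ) | H.Adj p.1 p.2} ∧
    (∀ x, (H.neighborSet x).encard = n) ∧
    H.IsAcyclic ∧
    borelChromaticNumber H.Adj = ((n + 1 : ℕ) : Cardinal) := by
  have : NeZero n := ⟨by omega⟩
  simp only [cayleyAdj_iff] at hH
  refine ⟨?_, encard_neighborSet hH, isAcyclic_of_adj_iff hH, borelChromaticNumber_eq hH⟩
  simp only [hH]
  exact measurableSet_freeFlip_adj
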